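/- There exist constants A > 0 and t₀ ≥ e such that every zero ρ = β + iγ of Riemann's auxiliary function R with γ ≥ t₀ satisfies β ≥ −A · γ^{2/5} · log γ. -/

import Mathlib

open MeasureTheory

/-- The straight line of slope 1 crossing the real axis at `1/2`,
parametrized from upper right to lower left. -/
noncomputable def rline (u : ℝ) : ℂ :=
  1 / 2 - Complex.exp (Real.pi * Complex.I / 4) * (u : ℂ)

/-- Riemann's auxiliary function
`R(s) = ∫_{0↙1} x^{-s} e^{πix²}/(e^{πix} − e^{-πix}) dx`, written out as an
integral over the real parameter of the line `0↙1`. Here `z ^ (-s)` is the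
principal power `exp (−s Log z)`. -/
noncomputable def RiemannR (s : ℂ) : ℂ :=
  -Complex.exp (Real.pi * Complex.I / 4) *
    ∫ u : ℝ, (rline u) ^ (-s) *
      Complex.exp (Real.pi * Complex.I * (rline u) ^ 2) /
      (Complex.exp (Real.pi * Complex.I * rline u) -
        Complex.exp (-(Real.pi * Complex.I * rline u)))

open Filter Topology Set

/-- `e^{-iπ/4}` -/
noncomputable def cc : ℂ := Complex.exp (-(Real.pi * Complex.I / 4))

lemma cc_eq : cc = (Real.sqrt 2 / 2 : ℝ) - (Real.sqrt 2 / 2 : ℝ) * Complex.I := by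
  have h : -((Real.pi : ℂ) * Complex.I / 4) = ((-(Real.pi / 4) : ℝ) : ℂ) * Complex.I := by
    push_cast; ring
  rw [cc, h, Complex.exp_mul_I, ← Complex.ofReal_cos, ← Complex.ofReal_sin, Real.cos_neg,
    Real.sin_neg, Real.cos_pi_div_four, Real.sin_pi_div_four]
  push_cast; ring

lemma cc_re : cc.re = Real.sqrt 2 / 2 := by rw [cc_eq]; simp
lemma cc_im : cc.im = -(Real.sqrt 2 / 2) := by rw [cc_eq]; simp
lemma cc_sq : cc ^ 2 = -Complex.I := by
  rw [cc, ← Complex.exp_nat_mul]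
  have : ((2 : ℕ) : ℂ) * -((Real.pi : ℂ) * Complex.I / 4) = -(Real.pi / 2 * Complex.I) := by
    push_cast; ring
  rw [this, Complex.exp_neg, Complex.exp_pi_div_two_mul_I]; simp
lemma cc_ne : cc ≠ 0 := Complex.exp_ne_zero _

noncomputable def KK (z : ℂ) (a r : ℝ) : ℂ :=
  (r : ℂ) ^ z * Complex.exp (-(Real.pi * r ^ 2) - 2 * Real.pi * cc * a * r)

noncomputable def HH (z : ℂ) (a : ℝ) : ℂ := ∫ r in Ioi (0 : ℝ), KK z a r

lemma norm_KK (z : ℂ) (a r : ℝ) (hr : 0 < r) :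
    ‖KK z a r‖ = r ^ z.re * Real.exp (-(Real.pi * r ^ 2) - Real.sqrt 2 * Real.pi * a * r) := by
  rw [KK, norm_mul, Complex.norm_cpow_eq_rpow_re_of_pos hr, Complex.norm_exp]
  congr 2
  have h1 : -((Real.pi : ℂ) * r ^ 2) - 2 * Real.pi * cc * a * r =
    ((-(Real.pi * r ^ 2) : ℝ) : ℂ) - ((2 * Real.pi * a * r : ℝ) : ℂ) * cc := by push_cast; ring
  rw [h1, Complex.sub_re, Complex.ofReal_re, Complex.re_ofReal_mul, cc_re]; ring

lemma norm_KK_le (z : ℂ) (a r : ℝ) (hr : 0 < r) :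
    ‖KK z a r‖ ≤ r ^ z.re * Real.exp (-(Real.sqrt 2 * Real.pi * a) * r) := by
  rw [norm_KK z a r hr]
  gcongr
  have : 0 ≤ Real.pi * r ^ 2 := by positivity
  linarith

lemma integrableOn_bound (n b : ℝ) (hn : -1 < n) (hb : 0 < b) :
    IntegrableOn (fun r : ℝ => r ^ n * Real.exp (-b * r)) (Ioi 0) := by
  simpa using integrableOn_rpow_mul_exp_neg_mul_rpow (p := 1) hn one_pos hb

lemma KK_continuousOn (z : ℂ) (a : ℝ) : ContinuousOn (KK z a) (Ioi 0) := by
  intro r hr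
  apply ContinuousAt.continuousWithinAt
  unfold KK
  apply ContinuousAt.mul
  · exact Complex.continuousAt_ofReal_cpow_const _ _ (Or.inr (ne_of_gt hr))
  · fun_prop

lemma KK_meas (z : ℂ) (a : ℝ) : AEStronglyMeasurable (KK z a) (volume.restrict (Ioi 0)) :=
  (KK_continuousOn z a).aestronglyMeasurable measurableSet_Ioi

lemma KK_integrable (z : ℂ) (a : ℝ) (hz : -1 < z.re) (ha : 0 < a) :
    IntegrableOn (KK z a) (Ioi 0) := by
  refine Integrable.mono' (integrableOn_bound z.re (Real.sqrt 2 * Real.pi * a) hz (by positivity))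
    (KK_meas z a) ?_
  filter_upwards [ae_restrict_mem measurableSet_Ioi] with r hr
  exact norm_KK_le z a r hr

lemma KK_succ (z : ℂ) (a r : ℝ) (hr : 0 < r) : KK (z + 1) a r = r * KK z a r := by
  unfold KK
  rw [Complex.cpow_add _ _ (by exact_mod_cast hr.ne'), Complex.cpow_one]; ring

lemma HH_hasDerivAt (z : ℂ) (a : ℝ) (hz : -1 < z.re) (ha : 0 < a) :
    HasDerivAt (HH z) (-(2 * Real.pi * cc) * HH (z + 1) a) a := by
  have key := hasDerivAt_integral_of_dominated_loc_of_deriv_le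
    (μ := volume.restrict (Ioi (0 : ℝ))) (F := fun a r => KK z a r)
    (F' := fun a r => -(2 * Real.pi * cc) * KK (z + 1) a r) (x₀ := a) (s := Ioi (a / 2))
    (bound := fun r => ‖(2 * Real.pi * cc : ℂ)‖ *
      (r ^ (z + 1).re * Real.exp (-(Real.sqrt 2 * Real.pi * (a / 2)) * r)))
    (Ioi_mem_nhds (by linarith)) (Eventually.of_forall fun x => KK_meas z x)
    (KK_integrable z a hz ha) ((KK_meas (z + 1) a).const_mul _) ?_ ?_ ?_
  · have := key.2
    rw [integral_const_mul] at this
    exact this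
  · filter_upwards [ae_restrict_mem measurableSet_Ioi] with r hr x hx
    rw [norm_mul, norm_neg]
    gcongr
    refine (norm_KK_le _ _ r hr).trans ?_
    have hr' : 0 < r := hr
    gcongr
    exact hx.le
  · refine (integrableOn_bound _ _ ?_ (by positivity)).const_mul _
    simp; linarith
  · filter_upwards [ae_restrict_mem measurableSet_Ioi] with r hr x hx
    rw [KK_succ z x r hr]
    unfold KK
    have h1 : HasDerivAt (fun x : ℝ => -((Real.pi : ℂ) * r ^ 2) - 2 * Real.pi * cc * x * r)
        (-(2 * Real.pi * cc * r)) x := by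
      have := (((hasDerivAt_id x).ofReal_comp.const_mul (2 * Real.pi * cc)).mul_const
        (r : ℂ)).const_sub (-((Real.pi : ℂ) * r ^ 2))
      simpa using this
    exact (h1.cexp.const_mul ((r : ℂ) ^ z)).congr_deriv (by ring)

lemma HH_parts (z : ℂ) (a : ℝ) (hz : 0 < z.re) (ha : 0 < a) :
    (z + 1) * HH z a = 2 * Real.pi * HH (z + 2) a + 2 * Real.pi * cc * a * HH (z + 1) a := by
  have hd : ∀ r ∈ Ioi (0 : ℝ), HasDerivAt (KK (z + 1) a)
      ((z + 1) * KK z a r - 2 * Real.pi * KK (z + 2) a r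
        - 2 * Real.pi * cc * a * KK (z + 1) a r) r := by
    intro r hr
    have hr' : 0 < r := hr
    have e1 : KK (z + 2) a r = r * (r * KK z a r) := by
      rw [← KK_succ z a r hr, ← KK_succ _ a r hr]; congr 1; ring
    rw [e1, KK_succ z a r hr]
    have h1 : HasDerivAt (fun r : ℝ => -((Real.pi : ℂ) * r ^ 2) - 2 * Real.pi * cc * a * r)
        (-(Real.pi * (2 * r)) - (2 * Real.pi * cc * a)) r := by
      have h2 := ((hasDerivAt_id r).ofReal_comp.pow 2).const_mul (Real.pi : ℂ)
      have h3 := ((hasDerivAt_id r).ofReal_comp.const_mul (2 * Real.pi * cc * a))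
      exact (h2.neg.sub h3).congr_deriv (by simp)
    have hz1 : z + 1 ≠ 0 := by
      intro h; have := congrArg Complex.re h; simp at this; linarith
    have h4 : HasDerivAt (fun r : ℝ => (r : ℂ) ^ (z + 1)) ((z + 1) * (r : ℂ) ^ z) r := by
      exact (hasDerivAt_ofReal_cpow_const hr'.ne' hz1).congr_deriv (by simp)
    have := h4.mul h1.cexp
    unfold KK
    refine this.congr_deriv ?_
    rw [Complex.cpow_add _ _ (by exact_mod_cast hr'.ne'), Complex.cpow_one]
    ring
  have i0 := KK_integrable z a (by linarith) ha
  have i1 := KK_integrable (z + 1) a (by simp; linarith) ha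
  have i2 := KK_integrable (z + 2) a (by simp; linarith) ha
  have bnd : ∀ r ∈ Ioi (0 : ℝ), ‖KK (z + 1) a r‖ ≤ r ^ (z + 1).re * Real.exp (-(Real.sqrt 2 * Real.pi * a) * r) :=
    fun r hr => norm_KK_le _ _ _ hr
  have t0 : Tendsto (KK (z + 1) a) (𝓝[>] 0) (𝓝 0) := by
    apply squeeze_zero_norm' (a := fun r => r ^ (z + 1).re * Real.exp (-(Real.sqrt 2 * Real.pi * a) * r))
    · filter_upwards [self_mem_nhdsWithin] with r hr using bnd r hr
    · have : Tendsto (fun r : ℝ => r ^ (z + 1).re * Real.exp (-(Real.sqrt 2 * Real.pi * a) * r)) (𝓝 0)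
          (𝓝 ((0:ℝ) ^ (z + 1).re * Real.exp (-(Real.sqrt 2 * Real.pi * a) * 0))) := by
        apply Tendsto.mul
        · exact (Real.continuousAt_rpow_const _ _ (Or.inr (by simp; linarith)))
        · exact Continuous.tendsto (by fun_prop) _
      rw [Real.zero_rpow (by simp; linarith), zero_mul] at this
      exact this.mono_left nhdsWithin_le_nhds
  have t1 : Tendsto (KK (z + 1) a) atTop (𝓝 0) := by
    apply squeeze_zero_norm' (a := fun r => r ^ (z + 1).re * Real.exp (-(Real.sqrt 2 * Real.pi * a) * r))
    · filter_upwards [eventually_gt_atTop 0] with r hr using bnd r hr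
    · exact tendsto_rpow_mul_exp_neg_mul_atTop_nhds_zero _ _ (by positivity)
  have v0 : KK (z + 1) a 0 = 0 := by
    unfold KK
    rw [Complex.ofReal_zero, Complex.zero_cpow, zero_mul]
    intro h; have := congrArg Complex.re h; simp at this; linarith
  have key := integral_Ioi_of_hasDerivAt_of_tendsto (a := 0) (m := 0) (f := KK (z+1) a)
    (by rw [← continuousWithinAt_Ioi_iff_Ici]; unfold ContinuousWithinAt; rw [v0]; exact t0) hd
    (((i0.const_mul _).sub (i2.const_mul _)).sub (i1.const_mul _)) t1
  have i3 : IntegrableOn (fun r => (z + 1) * KK z a r - 2 * Real.pi * KK (z + 2) a r) (Ioi 0) :=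
    (i0.const_mul _).sub (i2.const_mul _)
  rw [v0, integral_sub i3 (i1.const_mul _),
    integral_sub (i0.const_mul _) (i2.const_mul _), integral_const_mul, integral_const_mul,
    integral_const_mul] at key
  unfold HH
  linear_combination key

lemma gammaC_aux (z w : ℂ) (y : ℝ) (hy : 0 < y) :
    ‖(y : ℂ) ^ z * Complex.exp (-(w * y))‖ = y ^ z.re * Real.exp (-w.re * y) := by
  rw [norm_mul, Complex.norm_cpow_eq_rpow_re_of_pos hy, Complex.norm_exp]
  simp

lemma gammaC_meas (z w : ℂ) : AEStronglyMeasurable (fun y : ℝ => (y : ℂ) ^ z * Complex.exp (-(w * y)))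
    (volume.restrict (Ioi 0)) := by
  apply ContinuousOn.aestronglyMeasurable _ measurableSet_Ioi
  intro r hr
  apply ContinuousAt.continuousWithinAt
  apply ContinuousAt.mul
  · exact Complex.continuousAt_ofReal_cpow_const _ _ (Or.inr (ne_of_gt hr))
  · fun_prop

lemma gammaC (z w : ℂ) (hz : 0 < z.re) (hw : 0 < w.re) :
    ∫ y in Ioi (0 : ℝ), (y : ℂ) ^ z * Complex.exp (-(w * y)) =
      (1 / w) ^ (z + 1) * Complex.Gamma (z + 1) := by
  set U : Set ℂ := {w : ℂ | 0 < w.re} with hU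
  have hUo : IsOpen U := isOpen_lt continuous_const Complex.continuous_re
  have hUc : IsPreconnected U := (convex_halfSpace_re_gt 0).isPreconnected
  have d1 : DifferentiableOn ℂ (fun w => ∫ y in Ioi (0 : ℝ), (y : ℂ) ^ z * Complex.exp (-(w * y))) U := by
    intro w hw
    have hw' : 0 < w.re := hw
    have key := hasDerivAt_integral_of_dominated_loc_of_deriv_le
      (μ := volume.restrict (Ioi (0 : ℝ))) (F := fun (w : ℂ) (y : ℝ) => (y : ℂ) ^ z * Complex.exp (-(w * y)))
      (F' := fun (w : ℂ) (y : ℝ) => -((y : ℂ) ^ (z + 1) * Complex.exp (-(w * y)))) (x₀ := w)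
      (s := {v : ℂ | w.re / 2 < v.re})
      (bound := fun r => (r ^ (z + 1).re * Real.exp (-(w.re / 2) * r)))
      ((isOpen_lt continuous_const Complex.continuous_re).mem_nhds (by simp; linarith))
      (Eventually.of_forall fun x => gammaC_meas z x) ?_ ((gammaC_meas (z + 1) w).neg) ?_ ?_ ?_
    · exact key.2.differentiableAt.differentiableWithinAt
    · refine Integrable.mono' (integrableOn_bound z.re w.re (by linarith) hw) (gammaC_meas z w) ?_
      filter_upwards [ae_restrict_mem measurableSet_Ioi] with r hr
      exact (gammaC_aux z w r hr).le
    · filter_upwards [ae_restrict_mem measurableSet_Ioi] with r hr x hx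
      rw [norm_neg, gammaC_aux _ _ _ hr]
      have hr' : 0 < r := hr
      have hx' : w.re / 2 < x.re := hx
      gcongr
    · exact integrableOn_bound _ _ (by simp; linarith) (by linarith)
    · filter_upwards [ae_restrict_mem measurableSet_Ioi] with r hr x hx
      have hr' : 0 < r := hr
      rw [Complex.cpow_add _ _ (by exact_mod_cast hr'.ne'), Complex.cpow_one]
      have h1 : HasDerivAt (fun x : ℂ => -(x * r)) (-(1 * r)) x :=
        ((hasDerivAt_id x).mul_const (r : ℂ)).neg
      exact (h1.cexp.const_mul ((r : ℂ) ^ z)).congr_deriv (by ring)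
  have d2 : DifferentiableOn ℂ (fun w : ℂ => (1 / w) ^ (z + 1) * Complex.Gamma (z + 1)) U := by
    intro w hw
    have hw' : 0 < w.re := hw
    have hne : w ≠ 0 := by rintro rfl; simp at hw'
    apply DifferentiableAt.differentiableWithinAt
    apply DifferentiableAt.mul_const
    apply DifferentiableAt.cpow_const
    · exact (differentiableAt_const _).div differentiableAt_id hne
    · left
      rw [one_div, Complex.inv_re]
      exact div_pos hw' (Complex.normSq_pos.2 hne)
  refine (d1.analyticOnNhd hUo).eqOn_of_preconnected_of_frequently_eq (d2.analyticOnNhd hUo) hUc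
    (z₀ := 1) (by simp [hU]) ?_ hw
  have ht : Tendsto (fun x : ℝ => (x : ℂ)) (𝓝[>] 1) (𝓝[≠] 1) := by
    apply tendsto_nhdsWithin_iff.2 ⟨?_, ?_⟩
    · exact (Complex.continuous_ofReal.tendsto' 1 1 (by simp)).mono_left nhdsWithin_le_nhds
    · filter_upwards [self_mem_nhdsWithin] with x hx
      simp only [mem_compl_iff, mem_singleton_iff]
      intro h
      have : x = 1 := by exact_mod_cast h
      rw [this] at hx; simp at hx
  apply ht.frequently
  apply Eventually.frequently
  filter_upwards [self_mem_nhdsWithin] with x hx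
  have hx' : (1 : ℝ) < x := hx
  have := Complex.integral_cpow_mul_exp_neg_mul_Ioi (a := z + 1) (r := x) (by simp; linarith)
    (by linarith)
  rw [← this]; simp


noncomputable def LL (z : ℂ) : ℂ := (1 / (2 * Real.pi * cc)) ^ (z + 1) * Complex.Gamma (z + 1)

lemma tpc_ne : (2 * Real.pi * cc : ℂ) ≠ 0 := by
  have := cc_ne
  have h : (Real.pi : ℂ) ≠ 0 := by exact_mod_cast Real.pi_ne_zero
  simp [this]

lemma LL_ne (z : ℂ) (hz : 0 < z.re) : LL z ≠ 0 := by
  apply mul_ne_zero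
  · rw [Complex.cpow_def_of_ne_zero (one_div_ne_zero tpc_ne)]
    exact Complex.exp_ne_zero _
  · exact Complex.Gamma_ne_zero_of_re_pos (by simp; linarith)

lemma LL_succ (z : ℂ) (hz : 0 < z.re) : 2 * Real.pi * cc * LL (z + 1) = (z + 1) * LL z := by
  have hz1 : z + 1 ≠ 0 := by
    intro h; have := congrArg Complex.re h; simp at this; linarith
  unfold LL
  rw [Complex.Gamma_add_one _ hz1, Complex.cpow_add _ _ (one_div_ne_zero tpc_ne), Complex.cpow_one]
  field_simp [tpc_ne]
  have := cc_ne
  have h : (Real.pi : ℂ) ≠ 0 := by exact_mod_cast Real.pi_ne_zero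
  field_simp

lemma HH_scale (z : ℂ) (a : ℝ) (ha : 0 < a) :
    (a : ℂ) ^ z * a * HH z a = ∫ y in Ioi (0 : ℝ), (y : ℂ) ^ z *
      Complex.exp (-(Real.pi * (a⁻¹ * y : ℝ) ^ 2) - 2 * Real.pi * cc * y) := by
  have h := integral_comp_mul_left_Ioi (KK z a) 0 (inv_pos.2 ha)
  rw [mul_zero, inv_inv] at h
  unfold HH
  rw [mul_assoc, show (a : ℂ) * ∫ r in Ioi (0 : ℝ), KK z a r = a • ∫ r in Ioi (0 : ℝ), KK z a r from
    (Complex.real_smul).symm, ← h, ← integral_const_mul]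
  apply setIntegral_congr_fun measurableSet_Ioi
  intro y hy
  have hy' : 0 < y := hy
  have haC : (a : ℂ) ≠ 0 := by exact_mod_cast ha.ne'
  simp only [KK]
  rw [← mul_assoc, ← Complex.mul_cpow_ofReal_nonneg ha.le (by positivity)]
  congr 2
  · push_cast; field_simp
  · push_cast; field_simp

lemma HH_tendsto (z : ℂ) (hz : 0 < z.re) :
    Tendsto (fun a : ℝ => (a : ℂ) ^ z * a * HH z a) atTop (𝓝 (LL z)) := by
  have hL : LL z = ∫ y in Ioi (0 : ℝ), (y : ℂ) ^ z * Complex.exp (- (2 * Real.pi * cc * y)) := by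
    rw [LL, ← gammaC z _ hz]
    have : (2 * Real.pi * cc : ℂ) = ((2 * Real.pi : ℝ) : ℂ) * cc := by push_cast; ring
    rw [this, Complex.re_ofReal_mul, cc_re]; positivity
  rw [hL]
  have hev : (fun a : ℝ => ∫ y in Ioi (0 : ℝ), (y : ℂ) ^ z *
      Complex.exp (-(Real.pi * (a⁻¹ * y : ℝ) ^ 2) - 2 * Real.pi * cc * y)) =ᶠ[atTop]
      (fun a : ℝ => (a : ℂ) ^ z * a * HH z a) := by
    filter_upwards [eventually_gt_atTop 0] with a ha using (HH_scale z a ha).symm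
  refine Tendsto.congr' hev ?_
  apply tendsto_integral_filter_of_dominated_convergence
    (fun r => r ^ z.re * Real.exp (-(Real.sqrt 2 * Real.pi) * r))
  · filter_upwards with a
    apply ContinuousOn.aestronglyMeasurable _ measurableSet_Ioi
    intro r hr
    apply ContinuousAt.continuousWithinAt
    apply ContinuousAt.mul
    · exact Complex.continuousAt_ofReal_cpow_const _ _ (Or.inr (ne_of_gt hr))
    · fun_prop
  · filter_upwards with a
    filter_upwards [ae_restrict_mem measurableSet_Ioi] with r hr
    rw [norm_mul, Complex.norm_cpow_eq_rpow_re_of_pos hr, Complex.norm_exp]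
    have hr' : 0 < r := hr
    gcongr
    have h1 : -((Real.pi : ℂ) * (a⁻¹ * r : ℝ) ^ 2) - 2 * Real.pi * cc * r =
      ((-(Real.pi * (a⁻¹ * r) ^ 2) : ℝ) : ℂ) - ((2 * Real.pi * r : ℝ) : ℂ) * cc := by push_cast; ring
    rw [h1, Complex.sub_re, Complex.ofReal_re, Complex.re_ofReal_mul, cc_re]
    have : 0 ≤ Real.pi * (a⁻¹ * r) ^ 2 := by positivity
    linarith
  · exact integrableOn_bound _ _ (by linarith) (by positivity)
  · filter_upwards with r
    apply Tendsto.const_mul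
    apply (Complex.continuous_exp.tendsto _).comp
    have h1 : Tendsto (fun a : ℝ => ((a⁻¹ * r : ℝ) : ℂ)) atTop (𝓝 ((0 * r : ℝ) : ℂ)) :=
      (Complex.continuous_ofReal.tendsto _).comp (tendsto_inv_atTop_zero.mul_const r)
    have h2 := (((h1.pow 2).const_mul (Real.pi : ℂ)).neg).sub_const (2 * Real.pi * cc * r)
    simpa using h2

lemma HH_ev_ne (z : ℂ) (hz : 0 < z.re) : ∀ᶠ a in atTop, HH z a ≠ 0 := by
  filter_upwards [(HH_tendsto z hz).eventually_ne (LL_ne z hz)] with a ha h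
  exact ha (by rw [h, mul_zero])

lemma HH_ratio (z : ℂ) (hz : 0 < z.re) :
    Tendsto (fun a : ℝ => a * (-(2 * Real.pi * cc) * HH (z + 1) a) / HH z a) atTop
      (𝓝 (-(z + 1))) := by
  have h := (((HH_tendsto (z + 1) (by simp; linarith)).const_mul (-(2 * Real.pi * cc))).div
    (HH_tendsto z hz) (LL_ne z hz))
  have e : -(2 * Real.pi * cc) * LL (z + 1) / LL z = -(z + 1) := by
    rw [div_eq_iff (LL_ne z hz)]
    linear_combination -(LL_succ z hz)
  rw [e] at h
  refine h.congr' ?_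
  filter_upwards [eventually_gt_atTop 0, HH_ev_ne z hz] with a ha hne
  have haC : (a : ℂ) ≠ 0 := by exact_mod_cast ha.ne'
  have hp : (a : ℂ) ^ z ≠ 0 := by
    rw [Complex.cpow_def_of_ne_zero haC]; exact Complex.exp_ne_zero _
  simp only [Pi.div_apply]
  rw [Complex.cpow_add _ _ haC, Complex.cpow_one]
  field_simp

lemma aHH_tendsto (z : ℂ) (hz : 0 < z.re) :
    Tendsto (fun a : ℝ => a * HH z a) atTop (𝓝 0) := by
  have h0 : Tendsto (fun a : ℝ => (a : ℂ) ^ (-z)) atTop (𝓝 0) := by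
    apply squeeze_zero_norm' (a := fun a : ℝ => a ^ (-z.re))
    · filter_upwards [eventually_gt_atTop 0] with a ha
      rw [Complex.norm_cpow_eq_rpow_re_of_pos ha, Complex.neg_re]
    · exact tendsto_rpow_neg_atTop hz
  have h := h0.mul (HH_tendsto z hz)
  rw [zero_mul] at h
  refine h.congr' ?_
  filter_upwards [eventually_gt_atTop 0] with a ha
  have haC : (a : ℂ) ≠ 0 := by exact_mod_cast ha.ne'
  have hp : (a : ℂ) ^ z ≠ 0 := by
    rw [Complex.cpow_def_of_ne_zero haC]; exact Complex.exp_ne_zero _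
  rw [Complex.cpow_neg]
  field_simp

noncomputable def qq (T b a : ℝ) : ℂ := (T + Real.pi ^ 2 * a ^ 2 : ℝ) + (b : ℂ) * Complex.I
noncomputable def QQ (T b a : ℝ) : ℂ := Complex.exp (Complex.log (qq T b a) / 2)
noncomputable def ww (T b a : ℝ) : ℝ := T + b + Real.pi ^ 2 * a ^ 2

lemma qq_re (T b a : ℝ) : (qq T b a).re = T + Real.pi ^ 2 * a ^ 2 := by simp [qq, ← Complex.ofReal_pow]
lemma qq_im (T b a : ℝ) : (qq T b a).im = b := by simp [qq, ← Complex.ofReal_pow]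

lemma qq_ne (T b a : ℝ) (hb : 0 < b) : qq T b a ≠ 0 := by
  intro h; have := qq_im T b a; rw [h] at this; simp at this; linarith

lemma QQ_sq (T b a : ℝ) (hb : 0 < b) : QQ T b a ^ 2 = qq T b a := by
  rw [QQ, ← Complex.exp_nat_mul]
  have : ((2 : ℕ) : ℂ) * (Complex.log (qq T b a) / 2) = Complex.log (qq T b a) := by
    push_cast; ring
  rw [this, Complex.exp_log (qq_ne T b a hb)]

lemma QQ_ne (T b a : ℝ) : QQ T b a ≠ 0 := Complex.exp_ne_zero _

lemma QQ_re_pos (T b a : ℝ) (hb : 0 < b) : 0 < (QQ T b a).re := by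
  rw [QQ, Complex.exp_re]
  apply mul_pos (Real.exp_pos _)
  have h1 : (Complex.log (qq T b a) / 2).im = Complex.arg (qq T b a) / 2 := by
    rw [← Complex.log_im]; simp
  have h2 : Complex.arg (qq T b a) < Real.pi := by
    rcases lt_or_eq_of_le (Complex.arg_le_pi (qq T b a)) with h | h
    · exact h
    · rw [Complex.arg_eq_pi_iff] at h; rw [qq_im] at h; linarith [h.2]
  have h3 := Complex.neg_pi_lt_arg (qq T b a)
  rw [h1]
  apply Real.cos_pos_of_mem_Ioo
  constructor <;> linarith

lemma QQ_eqs (T b a : ℝ) (hb : 0 < b) :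
    (QQ T b a).re ^ 2 - (QQ T b a).im ^ 2 = T + Real.pi ^ 2 * a ^ 2 ∧
    2 * (QQ T b a).re * (QQ T b a).im = b ∧
    (QQ T b a).re ^ 2 + (QQ T b a).im ^ 2 = ‖qq T b a‖ := by
  have h := QQ_sq T b a hb
  have h1 := congrArg Complex.re h
  have h2 := congrArg Complex.im h
  rw [qq_re] at h1; rw [qq_im] at h2
  rw [pow_two] at h1 h2
  simp only [Complex.mul_re, Complex.mul_im] at h1 h2
  refine ⟨by linarith, by linarith, ?_⟩
  rw [← h, norm_pow, ← Complex.normSq_eq_norm_sq, Complex.normSq_apply]; ring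

lemma QQ_im_pos (T b a : ℝ) (hb : 0 < b) : 0 < (QQ T b a).im := by
  have := (QQ_eqs T b a hb).2.1
  have h := QQ_re_pos T b a hb
  by_contra hc
  push Not at hc
  nlinarith

lemma norm_qq_sq (T b a : ℝ) : ‖qq T b a‖ ^ 2 = (T + Real.pi ^ 2 * a ^ 2) ^ 2 + b ^ 2 := by
  rw [← Complex.normSq_eq_norm_sq, Complex.normSq_apply, qq_re, qq_im]; ring

lemma norm_qq_le (T b a : ℝ) (hT : 0 ≤ T) (hb : 0 < b) : ‖qq T b a‖ ≤ ww T b a := by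
  have h := norm_qq_sq T b a
  have : 0 ≤ T + Real.pi ^ 2 * a ^ 2 := by positivity
  unfold ww
  refine (sq_le_sq₀ (norm_nonneg _) (by linarith)).1 ?_
  nlinarith

lemma norm_qq_ge (T b a : ℝ) (hT : 0 ≤ T) (hb : 0 < b) : ww T b a ≤ 1.42 * ‖qq T b a‖ := by
  have h := norm_qq_sq T b a
  have : 0 ≤ T + Real.pi ^ 2 * a ^ 2 := by positivity
  unfold ww
  refine (sq_le_sq₀ (by positivity) (by positivity)).1 ?_
  nlinarith [sq_nonneg (T + Real.pi ^ 2 * a ^ 2 - b), sq_nonneg (‖qq T b a‖)]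

lemma ww_pos (T b a : ℝ) (hT : 0 ≤ T) (hb : 0 < b) : 0 < ww T b a := by
  unfold ww; positivity

lemma QQ_im_ge (T b a : ℝ) (hT : 0 ≤ T) (hb : 0 < b) :
    b / (2 * Real.sqrt (ww T b a)) ≤ (QQ T b a).im := by
  obtain ⟨h1, h2, h3⟩ := QQ_eqs T b a hb
  have hx := QQ_re_pos T b a hb
  have hy := QQ_im_pos T b a hb
  have h4 := norm_qq_le T b a hT hb
  have hs : (QQ T b a).re ≤ Real.sqrt (ww T b a) := by
    apply Real.le_sqrt_of_sq_le; nlinarith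
  rw [div_le_iff₀ (by linarith)]
  have := mul_le_mul_of_nonneg_right hs hy.le
  linarith

lemma qq_deriv (T b a : ℝ) : HasDerivAt (qq T b) (2 * Real.pi ^ 2 * a : ℝ) a := by
  unfold qq
  have h : HasDerivAt (fun a : ℝ => T + Real.pi ^ 2 * a ^ 2) (2 * Real.pi ^ 2 * a) a := by
    have := (((hasDerivAt_id a).pow 2).const_mul (Real.pi ^ 2)).const_add T
    exact this.congr_deriv (by simp; ring)
  exact h.ofReal_comp.add_const _

lemma QQ_deriv (T b a : ℝ) (hb : 0 < b) :
    HasDerivAt (QQ T b) (Real.pi ^ 2 * a / QQ T b a) a := by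
  have h := ((qq_deriv T b a).clog_real (by right; rw [qq_im]; exact hb.ne')).div_const 2 |>.cexp
  refine h.congr_deriv ?_
  change QQ T b a * _ = _
  rw [← QQ_sq T b a hb]
  have := QQ_ne T b a
  push_cast
  field_simp

noncomputable def uu0 (T b a : ℝ) : ℂ :=
  Complex.I * QQ T b a - Real.pi ^ 2 * a / (2 * qq T b a)

noncomputable def EE (T b a : ℝ) : ℂ :=
  5 * Real.pi ^ 4 * a ^ 2 / (4 * qq T b a ^ 2) - Real.pi ^ 2 / (2 * qq T b a)

lemma uu0_deriv (T b a : ℝ) (hb : 0 < b) :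
    HasDerivAt (uu0 T b) (EE T b a - uu0 T b a ^ 2 - qq T b a) a := by
  have hq := qq_ne T b a hb
  have h1 := (QQ_deriv T b a hb).const_mul Complex.I
  have h2 : HasDerivAt (fun a : ℝ => (Real.pi ^ 2 * a : ℂ)) (Real.pi ^ 2) a := by
    simpa using (hasDerivAt_id a).ofReal_comp.const_mul ((Real.pi : ℂ) ^ 2)
  have h3 := h2.div ((qq_deriv T b a).const_mul 2) (by simpa using hq)
  refine (h1.sub h3).congr_deriv ?_
  unfold EE uu0
  have hQ := QQ_ne T b a
  have hI := Complex.I_sq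
  rw [← QQ_sq T b a hb]
  push_cast
  field_simp
  ring_nf
  simp only [Complex.I_sq]
  ring

lemma EE_le (T b a : ℝ) (hT : 0 ≤ T) (hb : 0 < b) : ‖EE T b a‖ ≤ 25 / ww T b a := by
  have hq : 0 < ‖qq T b a‖ := norm_pos_iff.2 (qq_ne T b a hb)
  have hw := ww_pos T b a hT hb
  have hg := norm_qq_ge T b a hT hb
  have h1 : Real.pi ^ 2 * a ^ 2 ≤ ‖qq T b a‖ := by
    have := Complex.re_le_norm (qq T b a)
    rw [qq_re] at this; linarith
  have hpi : Real.pi ^ 2 ≤ 10 := by nlinarith [Real.pi_lt_d2, Real.pi_pos]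
  have h2 : ‖EE T b a‖ ≤ 5 * Real.pi ^ 4 * a ^ 2 / (4 * ‖qq T b a‖ ^ 2) + Real.pi ^ 2 / (2 * ‖qq T b a‖) := by
    unfold EE
    refine (norm_sub_le _ _).trans (le_of_eq ?_)
    simp only [norm_div, norm_mul, norm_pow, Complex.norm_real, Complex.norm_ofNat, Real.norm_eq_abs, abs_of_pos Real.pi_pos, sq_abs]
  refine h2.trans ?_
  have h3 : 5 * Real.pi ^ 4 * a ^ 2 / (4 * ‖qq T b a‖ ^ 2) ≤ 5 * 10 / (4 * ‖qq T b a‖) := by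
    rw [div_le_div_iff₀ (by positivity) (by positivity)]
    have : Real.pi ^ 4 * a ^ 2 ≤ 10 * ‖qq T b a‖ := by
      calc Real.pi ^ 4 * a ^ 2 = Real.pi ^ 2 * (Real.pi ^ 2 * a ^ 2) := by ring
        _ ≤ 10 * ‖qq T b a‖ := by gcongr
    nlinarith
  have h4 : Real.pi ^ 2 / (2 * ‖qq T b a‖) ≤ 10 / (2 * ‖qq T b a‖) := by gcongr
  have h5 : 5 * 10 / (4 * ‖qq T b a‖) + 10 / (2 * ‖qq T b a‖) = 17.5 / ‖qq T b a‖ := by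
    field_simp; norm_num
  have h6 : 17.5 / ‖qq T b a‖ ≤ 25 / ww T b a := by
    rw [div_le_div_iff₀ hq hw]; linarith
  linarith

lemma uu0_re (T b a : ℝ) (hT : 0 ≤ T) (hb : 0 < b) (ha : 0 ≤ a) :
    (uu0 T b a).re ≤ -(b / (2 * Real.sqrt (ww T b a))) := by
  have h1 := QQ_im_ge T b a hT hb
  have h2 : 0 ≤ ((Real.pi : ℂ) ^ 2 * a / (2 * qq T b a)).re := by
    have : ((Real.pi : ℂ) ^ 2 * a / (2 * qq T b a)) = ((Real.pi ^ 2 * a / 2 : ℝ) : ℂ) * (qq T b a)⁻¹ := by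
      have := qq_ne T b a hb
      push_cast; field_simp
    rw [this, Complex.re_ofReal_mul, Complex.inv_re, qq_re]
    have := Complex.normSq_nonneg (qq T b a)
    positivity
  unfold uu0
  rw [Complex.sub_re, Complex.I_mul_re]
  linarith


lemma hasDerivAt_re' {f : ℝ → ℂ} {f' : ℂ} {x : ℝ} (h : HasDerivAt f f' x) :
    HasDerivAt (fun x => (f x).re) f'.re x :=
  (Complex.reCLM.hasFDerivAt.comp_hasDerivAt x h)

lemma hasDerivAt_im' {f : ℝ → ℂ} {f' : ℂ} {x : ℝ} (h : HasDerivAt f f' x) :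
    HasDerivAt (fun x => (f x).im) f'.im x :=
  (Complex.imCLM.hasFDerivAt.comp_hasDerivAt x h)

noncomputable def TT (z : ℂ) : ℝ := -(2 * Real.pi * z.im)
noncomputable def bb (z : ℂ) : ℝ := 2 * Real.pi * z.re + Real.pi

noncomputable def HD (z : ℂ) (a : ℝ) : ℂ := -(2 * Real.pi * cc) * HH (z + 1) a

noncomputable def ph (a : ℝ) : ℂ := Complex.exp (Real.pi * Complex.I / 2 * a ^ 2)

lemma ph_norm (a : ℝ) : ‖ph a‖ = 1 := by
  have : (Real.pi * Complex.I / 2 * a ^ 2 : ℂ) = ((Real.pi / 2 * a ^ 2 : ℝ) : ℂ) * Complex.I := by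
    push_cast; ring
  rw [ph, this, Complex.norm_exp_ofReal_mul_I]

lemma ph_ne (a : ℝ) : ph a ≠ 0 := Complex.exp_ne_zero _

lemma ph_deriv (a : ℝ) : HasDerivAt ph (ph a * (Real.pi * Complex.I * a)) a := by
  have h : HasDerivAt (fun a : ℝ => (Real.pi * Complex.I / 2 * a ^ 2 : ℂ))
      (Real.pi * Complex.I * a) a := by
    have := ((hasDerivAt_id a).ofReal_comp.pow 2).const_mul (Real.pi * Complex.I / 2 : ℂ)
    exact this.congr_deriv (by simp; ring)
  exact h.cexp

noncomputable def vv (z : ℂ) (a : ℝ) : ℂ := ph a * HH z a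
noncomputable def vv1 (z : ℂ) (a : ℝ) : ℂ := ph a * (Real.pi * Complex.I * a * HH z a + HD z a)

lemma qq_z (z : ℂ) (a : ℝ) : qq (TT z) (bb z) a =
    Real.pi ^ 2 * a ^ 2 + Real.pi * Complex.I + 2 * Real.pi * Complex.I * z := by
  apply Complex.ext
  · rw [qq_re]; simp [TT, ← Complex.ofReal_pow]; ring
  · rw [qq_im]; simp [bb, ← Complex.ofReal_pow]; ring

lemma HH_d (z : ℂ) (a : ℝ) (hz : 0 < z.re) (ha : 0 < a) : HasDerivAt (HH z) (HD z a) a :=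
  HH_hasDerivAt z a (by linarith) ha

lemma HD_d (z : ℂ) (a : ℝ) (hz : 0 < z.re) (ha : 0 < a) :
    HasDerivAt (HD z) (-(2 * Real.pi * Complex.I) * ((z + 1) * HH z a + a * HD z a)) a := by
  have h := (HH_hasDerivAt (z + 1) a (by simp; linarith) ha).const_mul (-(2 * Real.pi * cc))
  refine h.congr_deriv ?_
  have hp := HH_parts z a hz ha
  rw [hp, HD]
  have h2 : z + 1 + 1 = z + 2 := by ring
  rw [h2]
  linear_combination (4 * Real.pi ^ 2 * HH (z + 2) a) * cc_sq

lemma vv_deriv (z : ℂ) (a : ℝ) (hz : 0 < z.re) (ha : 0 < a) :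
    HasDerivAt (vv z) (vv1 z a) a := by
  refine ((ph_deriv a).mul (HH_d z a hz ha)).congr_deriv ?_
  rw [vv1]; ring

lemma vv1_deriv (z : ℂ) (a : ℝ) (hz : 0 < z.re) (ha : 0 < a) :
    HasDerivAt (vv1 z) (-(qq (TT z) (bb z) a * vv z a)) a := by
  have hi : HasDerivAt (fun a : ℝ => (Real.pi * Complex.I * a : ℂ)) (Real.pi * Complex.I) a := by
    simpa using (hasDerivAt_id a).ofReal_comp.const_mul (Real.pi * Complex.I : ℂ)
  refine ((ph_deriv a).mul ((hi.mul (HH_d z a hz ha)).add (HD_d z a hz ha))).congr_deriv ?_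
  rw [qq_z, vv]
  simp only [Pi.add_apply, Pi.mul_apply]
  linear_combination (ph a * Real.pi ^ 2 * a ^ 2 * HH z a) * Complex.I_sq

lemma bb_pos (z : ℂ) (hz : 0 < z.re) : 0 < bb z := by
  unfold bb; positivity

noncomputable def MM (z : ℂ) (a : ℝ) : ℝ :=
  (vv z a).re * (vv1 z a).im - (vv z a).im * (vv1 z a).re

lemma MM_deriv (z : ℂ) (a : ℝ) (hz : 0 < z.re) (ha : 0 < a) :
    HasDerivAt (MM z) (-(bb z * ((vv z a).re ^ 2 + (vv z a).im ^ 2))) a := by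
  have h1 := vv_deriv z a hz ha
  have h2 := vv1_deriv z a hz ha
  refine (((hasDerivAt_re' h1).mul (hasDerivAt_im' h2)).sub
    ((hasDerivAt_im' h1).mul (hasDerivAt_re' h2))).congr_deriv ?_
  simp only [Complex.neg_re, Complex.neg_im, Complex.mul_re, Complex.mul_im, qq_re, qq_im]
  ring

lemma HH_tend0 (z : ℂ) (hz : 0 < z.re) : Tendsto (HH z) atTop (𝓝 0) := by
  have h := (aHH_tendsto z hz)
  have h2 : Tendsto (fun a : ℝ => ((a⁻¹ : ℝ) : ℂ)) atTop (𝓝 0) := by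
    have := (Complex.continuous_ofReal.tendsto 0).comp tendsto_inv_atTop_zero
    rw [Complex.ofReal_zero] at this; exact this
  have h3 := h2.mul h
  rw [mul_zero] at h3
  refine h3.congr' ?_
  filter_upwards [eventually_gt_atTop 0] with a ha
  have : (a : ℂ) ≠ 0 := by exact_mod_cast ha.ne'
  push_cast
  field_simp

lemma MM_tendsto (z : ℂ) (hz : 0 < z.re) : Tendsto (MM z) atTop (𝓝 0) := by
  have h1 := HH_tend0 z hz
  have h2 : Tendsto (HD z) atTop (𝓝 0) := by
    have := (HH_tend0 (z + 1) (by simp; linarith)).const_mul (-(2 * Real.pi * cc))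
    rw [mul_zero] at this; exact this
  have h3 : Tendsto (fun a => Real.pi * Complex.I * (a * HH z a) + HD z a) atTop (𝓝 0) := by
    have := ((aHH_tendsto z hz).const_mul (Real.pi * Complex.I : ℂ)).add h2
    simpa using this
  have h4 : Tendsto (fun a => ‖HH z a‖ * ‖Real.pi * Complex.I * (a * HH z a) + HD z a‖) atTop (𝓝 0) := by
    simpa using h1.norm.mul h3.norm
  refine squeeze_zero_norm (fun a => ?_) h4
  have e : MM z a = (starRingEnd ℂ (vv z a) * vv1 z a).im := by
    simp [MM]; ring
  rw [e, Real.norm_eq_abs]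
  refine (Complex.abs_im_le_norm _).trans (le_of_eq ?_)
  rw [norm_mul, RCLike.norm_conj, vv, vv1, norm_mul, norm_mul, ph_norm, one_mul, one_mul]
  ring_nf

lemma vv_ne (z : ℂ) (a : ℝ) (hz : 0 < z.re) (ha : 0 < a) : vv z a ≠ 0 := by
  intro h0
  have hb := bb_pos z hz
  have anti : AntitoneOn (MM z) (Ioi 0) := by
    apply antitoneOn_of_deriv_nonpos (convex_Ioi 0)
    · intro x hx; exact (MM_deriv z x hz hx).continuousAt.continuousWithinAt
    · intro x hx; rw [interior_Ioi] at hx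
      exact (MM_deriv z x hz hx).differentiableAt.differentiableWithinAt
    · intro x hx; rw [interior_Ioi] at hx
      rw [(MM_deriv z x hz hx).deriv]
      have : 0 ≤ bb z * ((vv z x).re ^ 2 + (vv z x).im ^ 2) := by positivity
      linarith
  have M0 : MM z a = 0 := by simp [MM, h0]
  have hM : ∀ x, a ≤ x → MM z x = 0 := by
    intro x hx
    apply le_antisymm
    · rw [← M0]; exact anti ha (lt_of_lt_of_le ha hx) hx
    · refine le_of_tendsto (MM_tendsto z hz) ?_
      filter_upwards [eventually_ge_atTop x] with y hy
      exact anti (lt_of_lt_of_le ha hx) (lt_of_lt_of_le ha (hx.trans hy)) hy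
  have hv : ∀ x, a < x → vv z x = 0 := by
    intro x hx
    have h1 := MM_deriv z x hz (ha.trans hx)
    have h2 : HasDerivAt (MM z) 0 x := by
      refine (hasDerivAt_const x (0 : ℝ)).congr_of_eventuallyEq ?_
      filter_upwards [lt_mem_nhds hx] with y hy using hM y hy.le
    have h3 := h1.unique h2
    have h4 : (vv z x).re ^ 2 + (vv z x).im ^ 2 = 0 := by
      rcases mul_eq_zero.1 (neg_eq_zero.1 h3) with h | h
      · exact absurd h hb.ne'
      · exact h
    apply Complex.ext
    · simp; nlinarith [sq_nonneg (vv z x).re, sq_nonneg (vv z x).im]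
    · simp; nlinarith [sq_nonneg (vv z x).re, sq_nonneg (vv z x).im]
  obtain ⟨x, hx1, hx2⟩ := ((HH_ev_ne z hz).and (eventually_gt_atTop a)).exists
  have := hv x hx2
  rw [vv] at this
  exact hx1 ((mul_eq_zero.1 this).resolve_left (ph_ne x))

noncomputable def uu (z : ℂ) (a : ℝ) : ℂ := vv1 z a / vv z a
noncomputable def rr (z : ℂ) (a : ℝ) : ℂ := uu z a - uu0 (TT z) (bb z) a

lemma uu_deriv (z : ℂ) (a : ℝ) (hz : 0 < z.re) (ha : 0 < a) :
    HasDerivAt (uu z) (-qq (TT z) (bb z) a - uu z a ^ 2) a := by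
  have hv := vv_ne z a hz ha
  refine ((vv1_deriv z a hz ha).div (vv_deriv z a hz ha) hv).congr_deriv ?_
  unfold uu
  field_simp

lemma rr_deriv (z : ℂ) (a : ℝ) (hz : 0 < z.re) (ha : 0 < a) :
    HasDerivAt (rr z) (-(rr z a * (rr z a + 2 * uu0 (TT z) (bb z) a)) - EE (TT z) (bb z) a) a := by
  refine ((uu_deriv z a hz ha).sub (uu0_deriv _ _ a (bb_pos z hz))).congr_deriv ?_
  unfold rr; ring

noncomputable def gg (z : ℂ) (a : ℝ) : ℝ :=
  ((rr z a).re ^ 2 + (rr z a).im ^ 2) * ww (TT z) (bb z) a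

lemma gg_eq (z : ℂ) (a : ℝ) : gg z a = ‖rr z a‖ ^ 2 * ww (TT z) (bb z) a := by
  rw [← Complex.normSq_eq_norm_sq, Complex.normSq_apply, gg]; ring

lemma ww_deriv (T b a : ℝ) : HasDerivAt (ww T b) (2 * Real.pi ^ 2 * a) a := by
  have := (((hasDerivAt_id a).pow 2).const_mul (Real.pi ^ 2)).const_add (T + b)
  exact this.congr_deriv (by simp; ring)

lemma gg_deriv (z : ℂ) (a : ℝ) (hz : 0 < z.re) (ha : 0 < a) :
    HasDerivAt (gg z) (2 * (starRingEnd ℂ (rr z a) * (-(rr z a * (rr z a + 2 * uu0 (TT z) (bb z) a)) - EE (TT z) (bb z) a)).re * ww (TT z) (bb z) a + ‖rr z a‖ ^ 2 * (2 * Real.pi ^ 2 * a)) a := by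
  have h := rr_deriv z a hz ha
  refine ((((hasDerivAt_re' h).pow 2).add ((hasDerivAt_im' h).pow 2)).mul (ww_deriv _ _ a)).congr_deriv ?_
  rw [← Complex.normSq_eq_norm_sq, Complex.normSq_apply]
  simp only [Pi.add_apply, Pi.pow_apply]
  generalize (-(rr z a * (rr z a + 2 * uu0 (TT z) (bb z) a)) - EE (TT z) (bb z) a) = d
  simp
  ring

lemma gg_deriv_pos (z : ℂ) (a : ℝ) (hz : 0 < z.re) (ht : z.im ≤ 0) (hb : 26 < bb z) (ha : 0 < a)
    (hg : gg z a = 1) :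
    0 < 2 * (starRingEnd ℂ (rr z a) * (-(rr z a * (rr z a + 2 * uu0 (TT z) (bb z) a)) - EE (TT z) (bb z) a)).re * ww (TT z) (bb z) a + ‖rr z a‖ ^ 2 * (2 * Real.pi ^ 2 * a) := by
  have hT : 0 ≤ TT z := by unfold TT; nlinarith [Real.pi_pos]
  have hw := ww_pos (TT z) (bb z) a hT (by linarith)
  have hE := EE_le (TT z) (bb z) a hT (by linarith)
  have hu := uu0_re (TT z) (bb z) a hT (by linarith) ha.le
  rw [gg_eq] at hg
  generalize hW : ww (TT z) (bb z) a = W at *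
  generalize uu0 (TT z) (bb z) a = u0 at *
  generalize EE (TT z) (bb z) a = E at *
  generalize rr z a = r at *
  generalize bb z = b at *
  have hsW : 0 < Real.sqrt W := Real.sqrt_pos.2 hw
  have hsq : Real.sqrt W ^ 2 = W := Real.sq_sqrt hw.le
  set S := Real.sqrt W with hS
  have hr : ‖r‖ = 1 / S := by
    have : (‖r‖ * S) ^ 2 = 1 := by rw [mul_pow, hsq]; exact hg
    have h1 : ‖r‖ * S = 1 := by
      have h0 : 0 ≤ ‖r‖ * S := by positivity
      nlinarith
    field_simp; linarith
  have e : (starRingEnd ℂ r * (-(r * (r + 2 * u0)) - E)).re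
      = -(‖r‖ ^ 2 * (r.re + 2 * u0.re)) - (starRingEnd ℂ r * E).re := by
    rw [← Complex.normSq_eq_norm_sq, Complex.normSq_apply]; simp; ring
  have h1 : (starRingEnd ℂ r * E).re ≤ ‖r‖ * (25 / W) := by
    refine (Complex.re_le_norm _).trans ?_
    rw [norm_mul, RCLike.norm_conj]
    gcongr
  have h2 : r.re ≤ ‖r‖ := Complex.re_le_norm r
  have h3 : r.re + 2 * u0.re ≤ 1 / S - b / S := by
    have : b / (2 * S) = b / S / 2 := by field_simp
    rw [this] at hu
    linarith
  have h4 : ‖r‖ ^ 2 * (r.re + 2 * u0.re) ≤ ‖r‖ ^ 2 * (1 / S - b / S) := by gcongr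
  have h5 : 0 < (starRingEnd ℂ r * (-(r * (r + 2 * u0)) - E)).re := by
    rw [e]
    have h6 : ‖r‖ ^ 2 * (1 / S - b / S) + ‖r‖ * (25 / W) < 0 := by
      rw [hr, ← hsq]
      have : (1 / S) ^ 2 * (1 / S - b / S) + 1 / S * (25 / S ^ 2) = (26 - b) / S ^ 3 := by
        field_simp; ring
      rw [this]
      apply div_neg_of_neg_of_pos (by linarith) (by positivity)
    linarith
  positivity

lemma QQ_over (T b : ℝ) (hb : 0 < b) :
    Tendsto (fun a : ℝ => QQ T b a / a) atTop (𝓝 (Real.pi : ℂ)) := by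
  rw [tendsto_iff_norm_sub_tendsto_zero]
  have h0 : Tendsto (fun a : ℝ => ‖(T + b * Complex.I : ℂ)‖ / Real.pi * (a ^ 2)⁻¹) atTop (𝓝 0) := by
    have := (tendsto_pow_atTop (α := ℝ) (n := 2) (by norm_num)).inv_tendsto_atTop.const_mul (‖(T + b * Complex.I : ℂ)‖ / Real.pi)
    rw [mul_zero] at this
    exact this
  refine squeeze_zero' (Eventually.of_forall fun a => norm_nonneg _) ?_ h0
  filter_upwards [eventually_gt_atTop 0] with a ha
  have hac : (a : ℂ) ≠ 0 := by exact_mod_cast ha.ne'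
  have h1 : (QQ T b a / a - Real.pi) * (QQ T b a / a + Real.pi) = (T + b * Complex.I) * ((a : ℂ) ^ 2)⁻¹ := by
    have := QQ_sq T b a hb
    field_simp
    rw [qq] at this
    push_cast at this
    linear_combination this
  have h2 : Real.pi ≤ ‖QQ T b a / a + Real.pi‖ := by
    refine le_trans ?_ (Complex.re_le_norm _)
    rw [Complex.add_re, Complex.ofReal_re, Complex.div_ofReal_re]
    have := QQ_re_pos T b a hb
    have : 0 < (QQ T b a).re / a := by positivity
    linarith
  have h3 := congrArg norm h1
  rw [norm_mul, norm_mul, norm_inv, norm_pow, Complex.norm_real, Real.norm_eq_abs, abs_of_pos ha] at h3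
  have hpi := Real.pi_pos
  rw [div_mul_eq_mul_div, le_div_iff₀ hpi, ← h3]
  gcongr

lemma arr_tendsto (z : ℂ) (hz : 0 < z.re) :
    Tendsto (fun a : ℝ => a * rr z a) atTop (𝓝 0) := by
  have hb := bb_pos z hz
  have h1 := HH_ratio z hz
  have h2 := QQ_over (TT z) (bb z) hb
  have hpi : (Real.pi : ℂ) ≠ 0 := by exact_mod_cast Real.pi_ne_zero
  have h3 : Tendsto (fun a : ℝ => -Complex.I * (TT z + bb z * Complex.I) / (QQ (TT z) (bb z) a / a + Real.pi))
      atTop (𝓝 (-Complex.I * (TT z + bb z * Complex.I) / (Real.pi + Real.pi))) := by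
    refine tendsto_const_nhds.div (h2.add_const _) ?_
    rw [← two_mul]; simpa using hpi
  have h4 : Tendsto (fun a : ℝ => (Real.pi : ℂ) ^ 2 / (2 * (QQ (TT z) (bb z) a / a) ^ 2)) atTop
      (𝓝 ((Real.pi : ℂ) ^ 2 / (2 * (Real.pi : ℂ) ^ 2))) := by
    refine tendsto_const_nhds.div ((h2.pow 2).const_mul 2) ?_
    simpa using hpi
  have h5 := (h1.add h3).add h4
  have e : -(z + 1) + -Complex.I * (TT z + bb z * Complex.I) / (Real.pi + Real.pi) + (Real.pi : ℂ) ^ 2 / (2 * (Real.pi : ℂ) ^ 2) = 0 := by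
    have hzz : z = z.re + z.im * Complex.I := (Complex.re_add_im z).symm
    have : (Real.pi : ℂ) ^ 2 / (2 * (Real.pi : ℂ) ^ 2) = 1 / 2 := by field_simp
    rw [this, ← two_mul]
    unfold TT bb
    push_cast
    field_simp
    ring_nf
    rw [Complex.I_sq]
    linear_combination (-2 : ℂ) * hzz
  rw [e] at h5
  refine h5.congr' ?_
  filter_upwards [eventually_gt_atTop 0, HH_ev_ne z hz] with a ha hH
  have hac : (a : ℂ) ≠ 0 := by exact_mod_cast ha.ne'
  have hQ := QQ_ne (TT z) (bb z) a
  have hs := QQ_sq (TT z) (bb z) a hb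
  have hp := ph_ne a
  have h6 : -Complex.I * (TT z + bb z * Complex.I) / (QQ (TT z) (bb z) a / a + Real.pi) = Complex.I * a * (Real.pi * a - QQ (TT z) (bb z) a) := by
    have hne : QQ (TT z) (bb z) a / a + Real.pi ≠ 0 := by
      intro h
      have h' := congrArg Complex.re h
      rw [Complex.add_re, Complex.ofReal_re, Complex.div_ofReal_re] at h'
      have := QQ_re_pos (TT z) (bb z) a hb
      have : 0 < (QQ (TT z) (bb z) a).re / a := by positivity
      have := Real.pi_pos
      simp at h'; linarith
    rw [div_eq_iff hne]
    rw [qq] at hs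
    push_cast at hs
    field_simp
    linear_combination hs
  rw [h6, rr, uu, uu0, vv, vv1, ← hs, HD]
  field_simp
  ring

lemma gg_tendsto (z : ℂ) (hz : 0 < z.re) : Tendsto (gg z) atTop (𝓝 0) := by
  have h1 := ((arr_tendsto z hz).norm.pow 2)
  have h2 : Tendsto (fun a : ℝ => (TT z + bb z) * (a ^ 2)⁻¹ + Real.pi ^ 2) atTop (𝓝 ((TT z + bb z) * 0 + Real.pi ^ 2)) :=
    ((tendsto_pow_atTop (α := ℝ) (n := 2) (by norm_num)).inv_tendsto_atTop.const_mul (TT z + bb z)).add_const _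
  have h3 := h1.mul h2
  rw [norm_zero, zero_pow two_ne_zero, zero_mul] at h3
  refine h3.congr' ?_
  filter_upwards [eventually_gt_atTop 0] with a ha
  rw [gg_eq, norm_mul, Complex.norm_real, Real.norm_eq_abs, abs_of_pos ha, ww]
  field_simp

lemma gg_le (z : ℂ) (a : ℝ) (hz : 0 < z.re) (ht : z.im ≤ 0) (hb : 26 < bb z) (ha : 0 < a) :
    gg z a ≤ 1 := by
  by_contra hc
  push Not at hc
  obtain ⟨y, hy1, hy2⟩ := (((gg_tendsto z hz).eventually (gt_mem_nhds (show (0 : ℝ) < 1 by norm_num))).and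
    (eventually_gt_atTop a)).exists
  have key := image_le_of_deriv_right_lt_deriv_boundary' (f := fun x => -gg z x) (a := a) (b := y)
    (B := fun _ => (-1 : ℝ)) (B' := fun _ => 0)
    (f' := fun a => -(2 * (starRingEnd ℂ (rr z a) * (-(rr z a * (rr z a + 2 * uu0 (TT z) (bb z) a)) - EE (TT z) (bb z) a)).re * ww (TT z) (bb z) a + ‖rr z a‖ ^ 2 * (2 * Real.pi ^ 2 * a)))
    (fun x hx => (gg_deriv z x hz (ha.trans_le hx.1)).neg.continuousAt.continuousWithinAt)
    (fun x hx => (gg_deriv z x hz (ha.trans_le hx.1)).neg.hasDerivWithinAt)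
    (by linarith) continuousOn_const (fun x hx => hasDerivWithinAt_const _ _ _)
    (fun x hx h => by
      have := gg_deriv_pos z x hz ht hb (ha.trans_le hx.1) (by linarith)
      linarith) (x := y) ⟨hy2.le, le_rfl⟩
  linarith

lemma rr_le (z : ℂ) (a : ℝ) (hz : 0 < z.re) (ht : z.im ≤ 0) (hb : 26 < bb z) (ha : 0 < a) :
    ‖rr z a‖ ≤ 1 / Real.sqrt (ww (TT z) (bb z) a) := by
  have h := gg_le z a hz ht hb ha
  have hT : 0 ≤ TT z := by unfold TT; nlinarith [Real.pi_pos]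
  have hw := ww_pos (TT z) (bb z) a hT (by linarith)
  rw [gg_eq] at h
  have hsW : 0 < Real.sqrt (ww (TT z) (bb z) a) := Real.sqrt_pos.2 hw
  rw [le_div_iff₀ hsW]
  rw [← Real.sq_sqrt hw.le, ← mul_pow] at h
  have h0 : 0 ≤ ‖rr z a‖ * Real.sqrt (ww (TT z) (bb z) a) := by positivity
  nlinarith

lemma uu_re_le (z : ℂ) (a : ℝ) (hz : 0 < z.re) (ht : z.im ≤ 0) (hb : 26 < bb z) (ha : 0 < a) :
    (uu z a).re ≤ -(bb z / (4 * Real.sqrt (ww (TT z) (bb z) a))) := by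
  have h := rr_le z a hz ht hb ha
  have hT : 0 ≤ TT z := by unfold TT; nlinarith [Real.pi_pos]
  have hw := ww_pos (TT z) (bb z) a hT (by linarith)
  have hu := uu0_re (TT z) (bb z) a hT (by linarith) ha.le
  have hsW : 0 < Real.sqrt (ww (TT z) (bb z) a) := Real.sqrt_pos.2 hw
  have e : (uu z a).re = (rr z a).re + (uu0 (TT z) (bb z) a).re := by
    rw [← Complex.add_re]; congr 1; unfold rr; ring
  rw [e]
  have h2 := Complex.re_le_norm (rr z a)
  have h3 : 1 / Real.sqrt (ww (TT z) (bb z) a) ≤ bb z / (4 * Real.sqrt (ww (TT z) (bb z) a)) := by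
    rw [div_le_div_iff₀ hsW (by positivity)]; nlinarith
  have h4 : bb z / (2 * Real.sqrt (ww (TT z) (bb z) a)) = 2 * (bb z / (4 * Real.sqrt (ww (TT z) (bb z) a))) := by
    field_simp; norm_num
  linarith

noncomputable def NN (z : ℂ) (a : ℝ) : ℝ := (vv z a).re ^ 2 + (vv z a).im ^ 2

lemma NN_eq (z : ℂ) (a : ℝ) : NN z a = ‖vv z a‖ ^ 2 := by
  rw [← Complex.normSq_eq_norm_sq, Complex.normSq_apply, NN]; ring

lemma NN_deriv (z : ℂ) (a : ℝ) (hz : 0 < z.re) (ha : 0 < a) :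
    HasDerivAt (NN z) (2 * NN z a * (uu z a).re) a := by
  have h := vv_deriv z a hz ha
  have hv := vv_ne z a hz ha
  have e : vv1 z a = uu z a * vv z a := by unfold uu; field_simp
  rw [e] at h
  refine (((hasDerivAt_re' h).pow 2).add ((hasDerivAt_im' h).pow 2)).congr_deriv ?_
  simp [NN]
  ring

lemma vv_anti (z : ℂ) (x y : ℝ) (hz : 0 < z.re) (ht : z.im ≤ 0) (hb : 26 < bb z) (hx : 0 < x)
    (hxy : x ≤ y) : ‖vv z y‖ ≤ ‖vv z x‖ := by
  have anti : AntitoneOn (NN z) (Ioi 0) := by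
    apply antitoneOn_of_deriv_nonpos (convex_Ioi 0)
    · intro x hx; exact (NN_deriv z x hz hx).continuousAt.continuousWithinAt
    · intro x hx; rw [interior_Ioi] at hx
      exact (NN_deriv z x hz hx).differentiableAt.differentiableWithinAt
    · intro x hx; rw [interior_Ioi] at hx
      rw [(NN_deriv z x hz hx).deriv]
      have h1 := uu_re_le z x hz ht hb hx
      have h2 : 0 ≤ bb z / (4 * Real.sqrt (ww (TT z) (bb z) x)) := by positivity
      have h3 : 0 ≤ NN z x := by unfold NN; positivity
      nlinarith
  have := anti hx (hx.trans_le hxy) hxy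
  rw [NN_eq, NN_eq] at this
  exact (sq_le_sq₀ (norm_nonneg _) (norm_nonneg _)).1 this

noncomputable def ss (z : ℂ) : ℝ := Real.sqrt (TT z + bb z)

lemma TT_nonneg (z : ℂ) (ht : z.im ≤ 0) : 0 ≤ TT z := by
  unfold TT; nlinarith [Real.pi_pos]

lemma sqrt_ww_le (z : ℂ) (a : ℝ) (hz : 0 < z.re) (ht : z.im ≤ 0) (ha : 0 ≤ a) :
    Real.sqrt (ww (TT z) (bb z) a) ≤ ss z + Real.pi * a := by
  have hT := TT_nonneg z ht
  have hb := bb_pos z hz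
  rw [Real.sqrt_le_left (by unfold ss; positivity)]
  have : ss z ^ 2 = TT z + bb z := Real.sq_sqrt (by linarith)
  have h2 : 0 ≤ ss z * (Real.pi * a) := by unfold ss; positivity
  unfold ww
  nlinarith

lemma ss_le_sqrt (z : ℂ) (a : ℝ) : ss z ≤ Real.sqrt (ww (TT z) (bb z) a) := by
  unfold ss ww
  apply Real.sqrt_le_sqrt
  have : 0 ≤ Real.pi ^ 2 * a ^ 2 := by positivity
  linarith

lemma ss_pos (z : ℂ) (hz : 0 < z.re) (ht : z.im ≤ 0) : 0 < ss z := by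
  have hT := TT_nonneg z ht
  have hb := bb_pos z hz
  unfold ss; positivity

lemma decay (z : ℂ) (hz : 0 < z.re) (ht : z.im ≤ 0) (hb : 60 ≤ bb z) (μ : ℝ) (hμ : 0 < μ) (hμ1 : μ ≤ 1)
    (hμ2 : μ * (32 * ss z) ≤ bb z) (k : ℕ) :
    ‖vv z (k + 1 / 2)‖ * (1 + μ * k) ^ 4 ≤ ‖vv z (1 / 2)‖ := by
  have hd : ∀ x : ℝ, 0 < x → HasDerivAt (fun x => NN z x * (1 + μ * (x - 1 / 2)) ^ 8)
      (2 * NN z x * (uu z x).re * (1 + μ * (x - 1 / 2)) ^ 8 + NN z x * (8 * (1 + μ * (x - 1 / 2)) ^ 7 * μ)) x := by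
    intro x hx
    have h1 : HasDerivAt (fun x : ℝ => 1 + μ * (x - 1 / 2)) μ x := by
      exact ((((hasDerivAt_id x).sub_const (1 / 2)).const_mul μ).const_add 1).congr_deriv (by simp)
    refine ((NN_deriv z x hz hx).mul (h1.pow 8)).congr_deriv ?_
    simp
  have anti : AntitoneOn (fun x => NN z x * (1 + μ * (x - 1 / 2)) ^ 8) (Ici (1 / 2)) := by
    apply antitoneOn_of_deriv_nonpos (convex_Ici _)
    · intro x hx; exact (hd x (by have := mem_Ici.1 hx; linarith)).continuousAt.continuousWithinAt
    · intro x hx; rw [interior_Ici] at hx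
      exact (hd x (by have := mem_Ioi.1 hx; linarith)).differentiableAt.differentiableWithinAt
    · intro x hx; rw [interior_Ici] at hx
      have hx1 : 1 / 2 < x := hx
      have hx0 : 0 < x := by linarith
      rw [(hd x hx0).deriv]
      have h1 := uu_re_le z x hz ht (by linarith) hx0
      have h3 : 0 ≤ NN z x := by unfold NN; positivity
      have h4 := sqrt_ww_le z x hz ht hx0.le
      have hW : 0 < Real.sqrt (ww (TT z) (bb z) x) := (ss_pos z hz ht).trans_le (ss_le_sqrt z x)
      have hm : 0 < 1 + μ * (x - 1 / 2) := by
        have : 0 < μ * (x - 1 / 2) := mul_pos hμ (by linarith)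
        linarith
      have h5 : 4 * μ ≤ bb z / (4 * Real.sqrt (ww (TT z) (bb z) x)) * (1 + μ * (x - 1 / 2)) := by
        rw [div_mul_eq_mul_div, le_div_iff₀ (by positivity)]
        have hpi := Real.pi_lt_d2
        have h6 : μ * Real.sqrt (ww (TT z) (bb z) x) ≤ μ * (ss z + Real.pi * x) := by gcongr
        have h7 : 0 ≤ μ * (x - 1 / 2) := mul_nonneg hμ.le (by linarith)
        have h8 : μ * (x - 1 / 2) * (16 * Real.pi) ≤ μ * (x - 1 / 2) * bb z := by
          gcongr; linarith
        have h9 : μ * Real.pi ≤ 1 * 3.15 := by gcongr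
        nlinarith
      have h10 : (uu z x).re * (1 + μ * (x - 1 / 2)) + 4 * μ ≤ 0 := by
        nlinarith
      have h11 : 2 * NN z x * (uu z x).re * (1 + μ * (x - 1 / 2)) ^ 8 + NN z x * (8 * (1 + μ * (x - 1 / 2)) ^ 7 * μ)
        = 2 * NN z x * (1 + μ * (x - 1 / 2)) ^ 7 * ((uu z x).re * (1 + μ * (x - 1 / 2)) + 4 * μ) := by ring
      rw [h11]
      exact mul_nonpos_of_nonneg_of_nonpos (by positivity) h10
  have h := anti (show (1 / 2 : ℝ) ∈ Ici (1 / 2) by simp)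
    (show (k + 1 / 2 : ℝ) ∈ Ici (1 / 2) by simp) (by simp)
  simp only [NN_eq, sub_self, mul_zero, add_zero, one_pow, mul_one, add_sub_cancel_right] at h
  refine (sq_le_sq₀ (by positivity) (norm_nonneg _)).1 ?_
  rw [mul_pow, ← pow_mul]
  exact h

noncomputable def wr (z : ℂ) (a : ℝ) : ℂ := vv z (a + 1) / vv z a

lemma vv_deriv_u (z : ℂ) (a : ℝ) (hz : 0 < z.re) (ha : 0 < a) :
    HasDerivAt (vv z) (uu z a * vv z a) a := by
  refine (vv_deriv z a hz ha).congr_deriv ?_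
  have := vv_ne z a hz ha
  unfold uu; field_simp

lemma ratio_cmp (z : ℂ) (a a' C : ℝ) (hz : 0 < z.re) (ht : z.im ≤ 0) (hb : 26 < bb z) (ha : 0 < a)
    (ha' : 0 < a')
    (hC : ∀ x ∈ Icc a (a + 1), ∀ y ∈ Icc a' (a' + 1), ‖uu z x - uu z y‖ ≤ C) :
    ‖wr z a - wr z a'‖ ≤ C := by
  have hv := vv_ne z a hz ha
  have hv' := vv_ne z a' hz ha'
  have hd : ∀ τ ∈ Icc (0 : ℝ) 1, HasDerivAt (fun τ => vv z (a + τ) * vv z (a' + 1 - τ) / (vv z a * vv z a'))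
      ((uu z (a + τ) - uu z (a' + 1 - τ)) * (vv z (a + τ) * vv z (a' + 1 - τ) / (vv z a * vv z a'))) τ := by
    intro τ hτ
    have h1 : HasDerivAt (fun τ => vv z (a + τ)) (uu z (a + τ) * vv z (a + τ)) τ := by
      have := (vv_deriv_u z (a + τ) hz (by linarith [hτ.1])).scomp τ ((hasDerivAt_id τ).const_add a)
      exact this.congr_deriv (by simp)
    have h2 : HasDerivAt (fun τ => vv z (a' + 1 - τ)) (-(uu z (a' + 1 - τ) * vv z (a' + 1 - τ))) τ := by
      have := (vv_deriv_u z (a' + 1 - τ) hz (by linarith [hτ.2])).scomp τ ((hasDerivAt_id τ).const_sub (a' + 1))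
      exact this.congr_deriv (by simp)
    refine ((h1.mul h2).div_const _).congr_deriv ?_
    ring
  have hb2 := norm_image_sub_le_of_norm_deriv_le_segment_01' (C := C) (fun τ hτ => (hd τ hτ).hasDerivWithinAt)
    (fun τ hτ => by
      have h0 := hτ.1
      have h1 := hτ.2
      have e1 := hC (a + τ) ⟨by linarith, by linarith⟩ (a' + 1 - τ) ⟨by linarith, by linarith⟩
      have e2 := vv_anti z a (a + τ) hz ht hb ha (by linarith)
      have e3 := vv_anti z a' (a' + 1 - τ) hz ht hb ha' (by linarith)
      rw [norm_mul, norm_div, norm_mul, norm_mul]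
      have p1 : 0 < ‖vv z a‖ := norm_pos_iff.2 hv
      have p2 : 0 < ‖vv z a'‖ := norm_pos_iff.2 hv'
      have : ‖vv z (a + τ)‖ * ‖vv z (a' + 1 - τ)‖ / (‖vv z a‖ * ‖vv z a'‖) ≤ 1 := by
        rw [div_le_one (by positivity)]
        gcongr
      calc _ ≤ C * 1 := by
            gcongr
            exact (norm_nonneg _).trans e1
        _ = C := mul_one C)
  have e : wr z a - wr z a' = vv z (a + 1) * vv z (a' + 1 - 1) / (vv z a * vv z a')
      - vv z (a + 0) * vv z (a' + 1 - 0) / (vv z a * vv z a') := by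
    unfold wr
    simp only [add_zero, sub_zero, add_sub_cancel_right]
    field_simp
  rw [e]
  exact hb2

lemma QQ_re_ge (T b a : ℝ) (hT : 0 ≤ T) (hb : 0 < b) : Real.sqrt (T + b) / 2 ≤ (QQ T b a).re := by
  obtain ⟨h1, h2, h3⟩ := QQ_eqs T b a hb
  have hx := QQ_re_pos T b a hb
  have h4 := norm_qq_ge T b a hT hb
  have hs : Real.sqrt (T + b) ^ 2 = T + b := Real.sq_sqrt (by linarith)
  have h5 : 0 ≤ Real.pi ^ 2 * a ^ 2 := by positivity
  unfold ww at h4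
  refine (sq_le_sq₀ (by positivity) hx.le).1 ?_
  nlinarith

lemma small_term (T b x : ℝ) (hT : 0 ≤ T) (hb : 0 < b) (hx : 0 ≤ x) :
    ‖(Real.pi ^ 2 * x / (2 * qq T b x) : ℂ)‖ ≤ 2 / Real.sqrt (T + b) := by
  have hs : Real.sqrt (T + b) ^ 2 = T + b := Real.sq_sqrt (by linarith)
  have hsp : 0 < Real.sqrt (T + b) := by positivity
  have hq : 0 < ‖qq T b x‖ := norm_pos_iff.2 (qq_ne T b x hb)
  have h4 := norm_qq_ge T b x hT hb
  rw [norm_div, norm_mul, norm_mul, norm_pow, Complex.norm_real, Complex.norm_real, Complex.norm_ofNat,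
    Real.norm_eq_abs, Real.norm_eq_abs, abs_of_pos Real.pi_pos, abs_of_nonneg hx]
  rw [div_le_div_iff₀ (by positivity) hsp]
  unfold ww at h4
  have hpi := Real.pi_lt_d2
  have h6 : 2 * (Real.pi * x) * Real.sqrt (T + b) ≤ 1.42 * ‖qq T b x‖ := by
    nlinarith [sq_nonneg (Real.pi * x - Real.sqrt (T + b))]
  have h7 : Real.pi * (2 * (Real.pi * x) * Real.sqrt (T + b)) ≤ 3.15 * (1.42 * ‖qq T b x‖) := by
    gcongr
  nlinarith

lemma uu_diff (z : ℂ) (x y L : ℝ) (hz : 0 < z.re) (ht : z.im ≤ 0) (hb : 26 < bb z) (hx : 0 < x)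
    (hy : 0 < y) (hxL : x ≤ L) (hyL : y ≤ L) :
    ‖uu z x - uu z y‖ ≤ (10 * L ^ 2 + 6) / ss z := by
  have hT := TT_nonneg z ht
  have hb0 := bb_pos z hz
  have hs := ss_pos z hz ht
  have r1 : ‖rr z x‖ ≤ 1 / ss z := (rr_le z x hz ht hb hx).trans (by
    gcongr; exact ss_le_sqrt z x)
  have r2 : ‖rr z y‖ ≤ 1 / ss z := (rr_le z y hz ht hb hy).trans (by
    gcongr; exact ss_le_sqrt z y)
  have t1 : ‖(Real.pi ^ 2 * x / (2 * qq (TT z) (bb z) x) : ℂ)‖ ≤ 2 / ss z := small_term _ _ x hT hb0 hx.le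
  have t2 : ‖(Real.pi ^ 2 * y / (2 * qq (TT z) (bb z) y) : ℂ)‖ ≤ 2 / ss z := small_term _ _ y hT hb0 hy.le
  have q1 : ss z / 2 ≤ (QQ (TT z) (bb z) x).re := QQ_re_ge _ _ x hT hb0
  have q2 : ss z / 2 ≤ (QQ (TT z) (bb z) y).re := QQ_re_ge _ _ y hT hb0
  have q3 : ss z ≤ ‖QQ (TT z) (bb z) x + QQ (TT z) (bb z) y‖ := by
    refine le_trans ?_ (Complex.re_le_norm _)
    rw [Complex.add_re]; linarith
  have q4 : (QQ (TT z) (bb z) x - QQ (TT z) (bb z) y) * (QQ (TT z) (bb z) x + QQ (TT z) (bb z) y)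
      = ((Real.pi ^ 2 * (x ^ 2 - y ^ 2) : ℝ) : ℂ) := by
    have e1 := QQ_sq (TT z) (bb z) x hb0
    have e2 := QQ_sq (TT z) (bb z) y hb0
    rw [qq] at e1 e2
    push_cast at e1 e2 ⊢
    linear_combination e1 - e2
  have q5 : ‖QQ (TT z) (bb z) x - QQ (TT z) (bb z) y‖ ≤ 10 * L ^ 2 / ss z := by
    have := congrArg norm q4
    rw [norm_mul, Complex.norm_real, Real.norm_eq_abs, abs_mul, abs_of_pos (by positivity : 0 < Real.pi ^ 2)] at this
    have hpi : Real.pi ^ 2 ≤ 10 := by nlinarith [Real.pi_lt_d2, Real.pi_pos]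
    have h1 : |x ^ 2 - y ^ 2| ≤ L ^ 2 := by
      rw [abs_le]; constructor <;> nlinarith
    rw [le_div_iff₀ hs]
    calc _ ≤ ‖QQ (TT z) (bb z) x - QQ (TT z) (bb z) y‖ * ‖QQ (TT z) (bb z) x + QQ (TT z) (bb z) y‖ := by gcongr
      _ = _ := this
      _ ≤ 10 * L ^ 2 := by gcongr
  have e : uu z x - uu z y = (rr z x - rr z y) + Complex.I * (QQ (TT z) (bb z) x - QQ (TT z) (bb z) y)
      - ((Real.pi ^ 2 * x / (2 * qq (TT z) (bb z) x) : ℂ) - (Real.pi ^ 2 * y / (2 * qq (TT z) (bb z) y) : ℂ)) := by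
    unfold rr uu0; ring
  rw [e]
  have n1 := norm_sub_le (rr z x) (rr z y)
  have n2 := norm_sub_le (Real.pi ^ 2 * x / (2 * qq (TT z) (bb z) x) : ℂ) (Real.pi ^ 2 * y / (2 * qq (TT z) (bb z) y) : ℂ)
  have n3 := norm_sub_le ((rr z x - rr z y) + Complex.I * (QQ (TT z) (bb z) x - QQ (TT z) (bb z) y)) ((Real.pi ^ 2 * x / (2 * qq (TT z) (bb z) x) : ℂ) - (Real.pi ^ 2 * y / (2 * qq (TT z) (bb z) y) : ℂ))
  have n4 := norm_add_le (rr z x - rr z y) (Complex.I * (QQ (TT z) (bb z) x - QQ (TT z) (bb z) y))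
  rw [norm_mul, Complex.norm_I, one_mul] at n4
  have : (10 * L ^ 2 + 6) / ss z = 10 * L ^ 2 / ss z + 1 / ss z + 1 / ss z + 2 / ss z + 2 / ss z := by
    field_simp; ring
  linarith

lemma wr_cmp (z : ℂ) (hz : 0 < z.re) (ht : z.im ≤ 0) (hb : 60 ≤ bb z) (k : ℕ) :
    ‖wr z (k + 1 / 2) - wr z (1 / 2)‖ ≤ 12 * (k + 2) ^ 2 / ss z := by
  have hs := ss_pos z hz ht
  refine ratio_cmp z (k + 1 / 2) (1 / 2) _ hz ht (by linarith) (by positivity) (by norm_num) ?_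
  intro x hx y hy
  have hk : (0 : ℝ) ≤ k := k.cast_nonneg
  refine (uu_diff z x y (k + 2) hz ht (by linarith) (by linarith [hx.1]) (by linarith [hy.1])
    (by linarith [hx.2]) (by linarith [hy.2])).trans ?_
  gcongr
  nlinarith

lemma wr_norm (z : ℂ) (a : ℝ) (hz : 0 < z.re) (ht : z.im ≤ 0) (hb : 60 ≤ bb z) (ha : 0 < a) :
    ‖wr z a‖ ≤ 1 := by
  have hv := norm_pos_iff.2 (vv_ne z a hz ha)
  rw [wr, norm_div, div_le_one hv]
  exact vv_anti z a (a + 1) hz ht (by linarith) ha (by linarith)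

lemma ph_two (k : ℕ) : ph (k + 2 + 1 / 2) = -ph (k + 1 / 2) := by
  unfold ph
  have : (Real.pi * Complex.I / 2 * ((k + 2 + 1 / 2 : ℝ) : ℂ) ^ 2 : ℂ)
      = Real.pi * Complex.I / 2 * ((k + 1 / 2 : ℝ) : ℂ) ^ 2 + (((k + 1 : ℕ) : ℂ) * (2 * Real.pi * Complex.I) + Real.pi * Complex.I) := by
    push_cast; ring
  rw [this, Complex.exp_add, Complex.exp_add, Complex.exp_nat_mul_two_pi_mul_I, Complex.exp_pi_mul_I]
  ring

lemma ph_one : ph (1 + 1 / 2) = -ph (1 / 2) := by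
  unfold ph
  have : (Real.pi * Complex.I / 2 * ((1 + 1 / 2 : ℝ) : ℂ) ^ 2 : ℂ)
      = Real.pi * Complex.I / 2 * ((1 / 2 : ℝ) : ℂ) ^ 2 + (Real.pi * Complex.I) := by
    push_cast; ring
  rw [this, Complex.exp_add, Complex.exp_pi_mul_I]
  ring

lemma HH_one (z : ℂ) (hz : 0 < z.re) : HH z (1 + 1 / 2) = -(wr z (1 / 2) * HH z (1 / 2)) := by
  have hv := vv_ne z (1 / 2) hz (by norm_num)
  have hp := ph_ne (1 / 2)
  have h1 : vv z (1 + 1 / 2) = wr z (1 / 2) * vv z (1 / 2) := by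
    unfold wr; rw [add_comm (1 / 2 : ℝ) 1]; field_simp
  have h2 : ph (1 / 2) * (-HH z (1 + 1 / 2)) = ph (1 / 2) * (wr z (1 / 2) * HH z (1 / 2)) := by
    unfold vv at h1
    rw [ph_one] at h1
    linear_combination h1
  have := mul_left_cancel₀ hp h2
  rw [← this, neg_neg]

lemma HH_two (z : ℂ) (hz : 0 < z.re) (k : ℕ) : HH z (k + 2 + 1 / 2) =
    -(wr z (k + 1 / 2) * wr z (k + 1 + 1 / 2) * HH z (k + 1 / 2)) := by
  have hv := vv_ne z (k + 1 / 2) hz (by positivity)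
  have hv1 := vv_ne z (k + 1 + 1 / 2) hz (by positivity)
  have hp := ph_ne (k + 1 / 2)
  have h1 : vv z (k + 2 + 1 / 2) = wr z (k + 1 / 2) * wr z (k + 1 + 1 / 2) * vv z (k + 1 / 2) := by
    unfold wr
    have e1 : (k + 1 / 2 + 1 : ℝ) = k + 1 + 1 / 2 := by ring
    have e2 : (k + 1 + 1 / 2 + 1 : ℝ) = k + 2 + 1 / 2 := by ring
    rw [e1, e2]
    generalize vv z (k + 2 + 1 / 2) = A at *
    generalize vv z (k + 1 + 1 / 2) = B at *
    generalize vv z (k + 1 / 2) = D at *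
    field_simp
  have h2 : ph (k + 1 / 2) * (-HH z (k + 2 + 1 / 2)) = ph (k + 1 / 2) * (wr z (k + 1 / 2) * wr z (k + 1 + 1 / 2) * HH z (k + 1 / 2)) := by
    unfold vv at h1
    rw [ph_two] at h1
    linear_combination h1
  have := mul_left_cancel₀ hp h2
  rw [← this, neg_neg]

lemma vv_norm (z : ℂ) (a : ℝ) : ‖vv z a‖ = ‖HH z a‖ := by
  rw [vv, norm_mul, ph_norm, one_mul]

lemma main_ineq (z : ℂ) (hz : 0 < z.re) (ht : z.im ≤ 0) (hb : 60 ≤ bb z) (μ : ℝ) (hμ : 0 < μ) (hμ1 : μ ≤ 1)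
    (hμ2 : μ * (32 * ss z) ≤ bb z) (hS : HasSum (fun k : ℕ => HH z (k + 1 / 2)) 0) :
    ss z * μ ^ 5 ≤ 864 := by
  have hs := ss_pos z hz ht
  set h0 := HH z (1 / 2) with hh0
  set w0 := wr z (1 / 2) with hw0
  have hne : 0 < ‖h0‖ := by
    rw [hh0, ← vv_norm]; exact norm_pos_iff.2 (vv_ne z _ hz (by norm_num))
  have hS2 : HasSum (fun k : ℕ => HH z (k + 2 + 1 / 2)) (-(h0 * (1 - w0))) := by
    have := (hasSum_nat_add_iff' 2).2 hS
    simp only [Finset.sum_range_succ, Finset.sum_range_zero] at this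
    have ev : -(h0 * (1 - w0)) = 0 - (0 + HH z ((0 : ℕ) + 1 / 2) + HH z ((1 : ℕ) + 1 / 2)) := by
      have e := HH_one z hz
      push_cast
      rw [zero_add, zero_add, e]; ring
    have ef : (fun k : ℕ => HH z (k + 2 + 1 / 2)) = fun k : ℕ => HH z ((k + 2 : ℕ) + 1 / 2) := by
      funext k; push_cast; rfl
    rw [ev, ef]; exact this
  have hid : HasSum (fun k : ℕ => (wr z (k + 1 / 2) * wr z (k + 1 + 1 / 2) - w0 ^ 2) * HH z (k + 1 / 2)) (h0 * (1 - w0)) := by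
    have := (hS2.neg).sub (hS.mul_left (w0 ^ 2))
    have ev : h0 * (1 - w0) = - -(h0 * (1 - w0)) - w0 ^ 2 * 0 := by ring
    have ef : (fun k : ℕ => (wr z (k + 1 / 2) * wr z (k + 1 + 1 / 2) - w0 ^ 2) * HH z (k + 1 / 2)) =
        fun k : ℕ => -HH z (k + 2 + 1 / 2) - w0 ^ 2 * HH z (k + 1 / 2) := by
      funext k; rw [HH_two z hz k]; ring
    rw [ev, ef]; exact this
  have hterm : ∀ k : ℕ, ‖(wr z (k + 1 / 2) * wr z (k + 1 + 1 / 2) - w0 ^ 2) * HH z (k + 1 / 2)‖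
      ≤ ‖h0‖ * (216 / (ss z * μ ^ 4)) * (1 / ((k + 1 : ℕ) : ℝ) ^ 2) := by
    intro k
    have hk : (0 : ℝ) ≤ k := k.cast_nonneg
    have c1 := wr_cmp z hz ht hb k
    have c2 := wr_cmp z hz ht hb (k + 1)
    push_cast at c2
    have n1 := wr_norm z (k + 1 / 2) hz ht hb (by positivity)
    have n0 := wr_norm z (1 / 2) hz ht hb (by positivity)
    have d := decay z hz ht hb μ hμ hμ1 hμ2 k
    rw [vv_norm, vv_norm] at d
    have e : wr z (k + 1 / 2) * wr z (k + 1 + 1 / 2) - w0 ^ 2 =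
      wr z (k + 1 / 2) * (wr z (k + 1 + 1 / 2) - w0) + (wr z (k + 1 / 2) - w0) * w0 := by ring
    have b1 : ‖wr z (k + 1 / 2) * wr z (k + 1 + 1 / 2) - w0 ^ 2‖ ≤ 216 * (k + 1) ^ 2 / ss z := by
      rw [e]
      refine (norm_add_le _ _).trans ?_
      rw [norm_mul, norm_mul]
      calc _ ≤ 1 * (12 * ((k : ℝ) + 1 + 2) ^ 2 / ss z) + (12 * ((k : ℝ) + 2) ^ 2 / ss z) * 1 := by gcongr
        _ = (12 * ((k : ℝ) + 1 + 2) ^ 2 + 12 * ((k : ℝ) + 2) ^ 2) / ss z := by ring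
        _ ≤ _ := by gcongr; nlinarith
    have b2 : ‖HH z (k + 1 / 2)‖ ≤ ‖h0‖ / (μ * (k + 1)) ^ 4 := by
      rw [le_div_iff₀ (by positivity)]
      refine le_trans ?_ d
      gcongr
      nlinarith
    rw [norm_mul]
    calc _ ≤ 216 * (k + 1) ^ 2 / ss z * (‖h0‖ / (μ * (k + 1)) ^ 4) := by gcongr
      _ = _ := by push_cast; field_simp
  have hz2 : HasSum (fun k : ℕ => 1 / ((k + 1 : ℕ) : ℝ) ^ 2) (Real.pi ^ 2 / 6) := by
    have := (hasSum_nat_add_iff' 1).2 hasSum_zeta_two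
    simpa using this
  have hfin := tsum_of_norm_bounded (hz2.mul_left (‖h0‖ * (216 / (ss z * μ ^ 4)))) hterm
  rw [hid.tsum_eq, norm_mul] at hfin
  have hpi : Real.pi ^ 2 / 6 ≤ 2 := by nlinarith [Real.pi_lt_d2, Real.pi_pos]
  have h1 : ‖h0‖ * ‖1 - w0‖ ≤ ‖h0‖ * (432 / (ss z * μ ^ 4)) := by
    refine hfin.trans ?_
    calc _ ≤ ‖h0‖ * (216 / (ss z * μ ^ 4)) * 2 := by gcongr
      _ = _ := by ring
  have h2 := le_of_mul_le_mul_left h1 hne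
  have h3 : ‖w0‖ * (1 + μ) ≤ 1 := by
    have d := decay z hz ht hb μ hμ hμ1 hμ2 1
    have hv := norm_pos_iff.2 (vv_ne z (1 / 2) hz (by norm_num))
    have e : ‖w0‖ = ‖vv z (1 + 1 / 2)‖ / ‖vv z (1 / 2)‖ := by
      rw [hw0, wr, norm_div, add_comm (1 / 2 : ℝ) 1]
    rw [e, div_mul_eq_mul_div, div_le_one hv]
    push_cast at d
    rw [mul_one] at d
    refine le_trans ?_ d
    gcongr
    exact le_self_pow₀ (by linarith) (by norm_num)
  have h4 : μ / 2 ≤ ‖1 - w0‖ := by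
    have := norm_sub_norm_le (1 : ℂ) w0
    rw [norm_one] at this
    have : ‖w0‖ ≤ 1 - μ / 2 := by
      by_contra hc
      push Not at hc
      nlinarith
    linarith
  have h5 := h4.trans h2
  rw [le_div_iff₀ (by positivity)] at h5
  nlinarith

lemma strip_integrable (f : ℂ → ℂ) (h y K : ℝ) (hy : y ∈ Icc 0 h)
    (hc : ContinuousOn f {w : ℂ | 0 ≤ w.im ∧ w.im ≤ h})
    (hK : ∀ w : ℂ, 0 ≤ w.im → w.im ≤ h → ‖f w‖ ≤ K * Real.exp (-1 * w.re ^ 2)) :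
    Integrable (fun x : ℝ => f (x + y * Complex.I)) := by
  have hcont : Continuous (fun x : ℝ => f (x + y * Complex.I)) := by
    rw [← continuousOn_univ]
    refine hc.comp (by fun_prop) ?_
    intro x _
    simp; exact hy
  refine ((integrable_exp_neg_mul_sq one_pos).const_mul K).mono' hcont.aestronglyMeasurable ?_
  refine Eventually.of_forall fun x => ?_
  have := hK (x + y * Complex.I) (by simpa using hy.1) (by simpa using hy.2)
  simpa using this

lemma strip_shift (f : ℂ → ℂ) (h K : ℝ) (hh : 0 < h)
    (hc : ContinuousOn f {w : ℂ | 0 ≤ w.im ∧ w.im ≤ h})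
    (hd : ∀ w : ℂ, 0 < w.im → w.im < h → DifferentiableAt ℂ f w)
    (hK : ∀ w : ℂ, 0 ≤ w.im → w.im ≤ h → ‖f w‖ ≤ K * Real.exp (-1 * w.re ^ 2)) :
    ∫ x : ℝ, f (x + h * Complex.I) = ∫ x : ℝ, f x := by
  have i1 := strip_integrable f h h K ⟨hh.le, le_rfl⟩ hc hK
  have i0 := strip_integrable f h 0 K ⟨le_rfl, hh.le⟩ hc hK
  have t1 := intervalIntegral_tendsto_integral i1 tendsto_neg_atTop_atBot tendsto_id
  have t0 := intervalIntegral_tendsto_integral i0 tendsto_neg_atTop_atBot tendsto_id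
  have hexp : Tendsto (fun R : ℝ => K * Real.exp (-1 * R ^ 2) * |h - 0|) atTop (𝓝 0) := by
    have h1 : Tendsto (fun R : ℝ => Real.exp (-1 * R ^ 2)) atTop (𝓝 0) := by
      apply Real.tendsto_exp_atBot.comp
      have := tendsto_neg_atTop_atBot.comp (tendsto_pow_atTop (α := ℝ) (n := 2) (by norm_num))
      refine this.congr fun x => ?_
      simp
    simpa using (h1.const_mul K).mul_const |h - 0|
  have vb : ∀ R x : ℝ, x ^ 2 = R ^ 2 → ‖Complex.I • ∫ y in (0 : ℝ)..h, f (x + y * Complex.I)‖ ≤ K * Real.exp (-1 * R ^ 2) * |h - 0| := by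
    intro R x hx
    rw [norm_smul, Complex.norm_I, one_mul]
    refine intervalIntegral.norm_integral_le_of_norm_le_const fun y hy => ?_
    rw [uIoc_of_le hh.le] at hy
    have := hK (x + y * Complex.I) (by simpa using hy.1.le) (by simpa using hy.2)
    simpa [hx] using this
  have v1 : Tendsto (fun R : ℝ => Complex.I • ∫ y in (0 : ℝ)..h, f (R + y * Complex.I)) atTop (𝓝 0) :=
    squeeze_zero_norm (fun R => vb R R rfl) hexp
  have v2 : Tendsto (fun R : ℝ => Complex.I • ∫ y in (0 : ℝ)..h, f (((-R : ℝ) : ℂ) + y * Complex.I)) atTop (𝓝 0) :=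
    squeeze_zero_norm (fun R => vb R (-R) (by ring)) hexp
  have lim := (((t0.sub t1).add v1).sub v2)
  have lim0 : Tendsto (fun _ : ℝ => (0 : ℂ)) atTop (𝓝 ((∫ x : ℝ, f (x + (0 : ℝ) * Complex.I)) - (∫ x : ℝ, f (x + h * Complex.I)) + 0 - 0)) := by
    refine lim.congr' ?_
    filter_upwards [eventually_gt_atTop 0] with R hR
    have hle : -R ≤ R := by linarith
    have key := Complex.integral_boundary_rect_eq_zero_of_continuousOn_of_differentiableOn f
      (((-R : ℝ) : ℂ) + ((0 : ℝ) : ℂ) * Complex.I) ((R : ℂ) + (h : ℂ) * Complex.I) ?_ ?_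
    · simp only [Complex.add_re, Complex.ofReal_re, Complex.re_ofReal_mul, Complex.I_re, mul_zero, add_zero,
        Complex.add_im, Complex.ofReal_im, Complex.im_ofReal_mul, Complex.I_im, mul_one, zero_add] at key
      exact key
    · refine hc.mono ?_
      intro w hw
      have := hw.2
      simp [uIcc_of_le hh.le] at this
      exact this
    · intro w hw
      have := hw.2
      simp [hh.le] at this
      exact (hd w this.1 this.2).differentiableWithinAt
  have := tendsto_nhds_unique lim0 tendsto_const_nhds
  rw [add_zero, sub_zero, sub_eq_zero] at this
  rw [← this]
  simp

noncomputable def ee : ℂ := Complex.exp (Real.pi * Complex.I / 4)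
lemma ee_cc : ee * cc = 1 := by rw [ee, cc, ← Complex.exp_add]; simp
lemma ee_ne : ee ≠ 0 := Complex.exp_ne_zero _
lemma ee_norm : ‖ee‖ = 1 := by
  have : (Real.pi * Complex.I / 4 : ℂ) = ((Real.pi / 4 : ℝ) : ℂ) * Complex.I := by push_cast; ring
  rw [ee, this, Complex.norm_exp_ofReal_mul_I]
lemma ee_sq : ee ^ 2 = Complex.I := by
  have h1 := ee_cc
  have h2 := cc_sq
  have h3 : ee ^ 2 * cc ^ 2 = 1 := by rw [← mul_pow, h1, one_pow]
  rw [h2] at h3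
  linear_combination Complex.I * h3 + ee ^ 2 * Complex.I_sq
lemma ee_I : Complex.I * ee = -cc := by
  rw [← ee_sq]
  have h1 := ee_cc
  have h2 := cc_sq
  have h3 := ee_sq
  have : ee ^ 2 * ee * (ee * cc) = -cc * (ee * cc) := by
    linear_combination (ee ^ 2 * cc + cc * Complex.I) * h3 + cc * Complex.I_sq + cc * h1
  rw [h1] at this
  simpa using this
lemma ee_eq : ee = (Real.sqrt 2 / 2 : ℝ) + (Real.sqrt 2 / 2 : ℝ) * Complex.I := by
  have h := ee_I
  rw [cc_eq] at h
  linear_combination (-Complex.I) * h + (ee - (Real.sqrt 2 / 2 : ℝ)) * Complex.I_sq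

noncomputable def DD (w : ℂ) : ℂ := Complex.exp (Real.pi * cc * w) - Complex.exp (-(Real.pi * cc * w))
noncomputable def ff (z w : ℂ) : ℂ := (-(ee * w)) ^ z * Complex.exp (-(Real.pi * w ^ 2)) / DD w

lemma DD_diff : Differentiable ℂ DD := by unfold DD; fun_prop

lemma cw_re (w : ℂ) : (Real.pi * cc * w).re = Real.pi * (Real.sqrt 2 / 2) * (w.re + w.im) := by
  rw [cc_eq]; simp; ring
lemma cw_im (w : ℂ) : (Real.pi * cc * w).im = Real.pi * (Real.sqrt 2 / 2) * (w.im - w.re) := by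
  rw [cc_eq]; simp; ring

lemma DD_ge (w : ℂ) : 2 * |Real.pi * (Real.sqrt 2 / 2) * (w.re + w.im)| ≤ ‖DD w‖ := by
  have h1 : |Real.exp (Real.pi * cc * w).re - Real.exp (-(Real.pi * cc * w).re)| ≤ ‖DD w‖ := by
    have := abs_norm_sub_norm_le (Complex.exp (Real.pi * cc * w)) (Complex.exp (-(Real.pi * cc * w)))
    rwa [Complex.norm_exp, Complex.norm_exp, Complex.neg_re] at this
  refine le_trans ?_ h1
  rw [← cw_re]
  generalize (Real.pi * cc * w).re = p
  have : Real.exp p - Real.exp (-p) = 2 * Real.sinh p := by rw [Real.sinh_eq]; ring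
  rw [this, abs_mul, abs_two]
  refine mul_le_mul_of_nonneg_left ?_ zero_le_two
  rcases le_total 0 p with h | h
  · rw [abs_of_nonneg h]; exact (Real.self_le_sinh_iff.2 h).trans (le_abs_self _)
  · rw [abs_of_nonpos h]
    have := Real.self_le_sinh_iff.2 (neg_nonneg.2 h)
    rw [Real.sinh_neg] at this
    exact this.trans (neg_le_abs _)

lemma DD_ne (w : ℂ) (h1 : 0 ≤ w.im) (h2 : w.im ≤ Real.sqrt 2 / 4) (hw : w ≠ 0) : DD w ≠ 0 := by
  intro h
  have hs : Real.sqrt 2 ^ 2 = 2 := Real.sq_sqrt (by norm_num)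
  have hs0 : 0 < Real.sqrt 2 := by positivity
  have hpi := Real.pi_pos
  have hg := DD_ge w
  rw [h, norm_zero] at hg
  have hg2 : Real.pi * (Real.sqrt 2 / 2) * (w.re + w.im) = 0 := by
    rw [← abs_eq_zero]; linarith [abs_nonneg (Real.pi * (Real.sqrt 2 / 2) * (w.re + w.im))]
  have hx : w.re + w.im = 0 := by
    rcases mul_eq_zero.1 hg2 with h | h
    · have : 0 < Real.pi * (Real.sqrt 2 / 2) := by positivity
      linarith
    · exact h
  have e : (Real.pi * cc * w : ℂ) = ((Real.pi * Real.sqrt 2 * w.im : ℝ) : ℂ) * Complex.I := by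
    apply Complex.ext
    · rw [cw_re, hg2]; simp
    · rw [cw_im, show w.re = -w.im by linarith]; simp; ring
  have hsin : Real.sin (Real.pi * Real.sqrt 2 * w.im) = 0 := by
    have h' := congrArg Complex.im h
    rw [DD, e, ← neg_mul, ← Complex.ofReal_neg, Complex.sub_im, Complex.exp_ofReal_mul_I_im, Complex.exp_ofReal_mul_I_im, Real.sin_neg] at h'
    simp at h'; linarith
  have him : w.im ≠ 0 := by
    intro h0; apply hw; apply Complex.ext
    · simp; linarith
    · simpa using h0
  have hpos : 0 < w.im := lt_of_le_of_ne h1 him.symm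
  have : 0 < Real.sin (Real.pi * Real.sqrt 2 * w.im) := by
    apply Real.sin_pos_of_pos_of_lt_pi (by positivity)
    have : Real.sqrt 2 * w.im ≤ Real.sqrt 2 * (Real.sqrt 2 / 4) := by gcongr
    nlinarith
  linarith

lemma ew_cond (w : ℂ) (h1 : 0 ≤ w.im) : 0 ≤ (-(ee * w)).re ∨ (-(ee * w)).im ≠ 0 := by
  by_cases h : (-(ee * w)).im = 0
  · left
    rw [ee_eq] at h ⊢
    simp at h ⊢
    have hs0 : 0 < Real.sqrt 2 := by positivity
    have : w.im + w.re = 0 := by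
      have : Real.sqrt 2 / 2 * (w.im + w.re) = 0 := by linarith
      rcases mul_eq_zero.1 this with h | h
      · linarith
      · exact h
    nlinarith
  · right; exact h

noncomputable def ED (w : ℂ) : ℂ := dslope DD 0 w

lemma ED_diff : Differentiable ℂ ED := by
  have := (Complex.differentiableOn_dslope (f := DD) (s := univ) (c := 0) univ_mem).2 DD_diff.differentiableOn
  exact differentiableOn_univ.1 this

lemma DD_ED (w : ℂ) : DD w = w * ED w := by
  have := sub_smul_dslope DD 0 w
  have h0 : DD 0 = 0 := by simp [DD]
  rw [sub_zero, h0, sub_zero, smul_eq_mul] at this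
  rw [ED, this]

lemma ED_ne (w : ℂ) (h1 : 0 ≤ w.im) (h2 : w.im ≤ Real.sqrt 2 / 4) : ED w ≠ 0 := by
  by_cases hw : w = 0
  · rw [hw, ED, dslope_same]
    have : HasDerivAt DD (2 * Real.pi * cc) 0 := by
      have e1 : HasDerivAt (fun w : ℂ => Real.pi * cc * w) (Real.pi * cc) 0 := by
        simpa using (hasDerivAt_id (0 : ℂ)).const_mul (Real.pi * cc)
      refine (e1.cexp.sub e1.neg.cexp).congr_deriv ?_
      simp; ring
    rw [this.deriv]; exact tpc_ne
  · have := DD_ne w h1 h2 hw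
    rw [DD_ED] at this
    exact right_ne_zero_of_mul this

lemma ff_eq (z w : ℂ) (hz : 1 < z.re) : ff z w = -ee * (-(ee * w)) ^ (z - 1) * Complex.exp (-(Real.pi * w ^ 2)) / ED w := by
  by_cases hw : w = 0
  · have : z - 1 ≠ 0 := by
      intro h; have := congrArg Complex.re h; simp at this; linarith
    simp [ff, hw, DD, this]
  · have h1 : (-(ee * w)) ≠ 0 := neg_ne_zero.2 (mul_ne_zero ee_ne hw)
    rw [ff, DD_ED, Complex.cpow_sub _ _ h1, Complex.cpow_one]
    have := ee_ne
    field_simp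

lemma ff_cont (z : ℂ) (hz : 1 < z.re) : ContinuousOn (ff z) {w : ℂ | 0 ≤ w.im ∧ w.im ≤ Real.sqrt 2 / 4} := by
  have : ff z = fun w => -ee * (-(ee * w)) ^ (z - 1) * Complex.exp (-(Real.pi * w ^ 2)) / ED w := by
    funext w; exact ff_eq z w hz
  rw [this]
  intro w hw
  apply ContinuousAt.continuousWithinAt
  have c1 : ContinuousAt (fun w : ℂ => (-(ee * w)) ^ (z - 1)) w := by
    have := Complex.continuousAt_cpow_const_of_re_pos (ew_cond w hw.1) (w := z - 1) (by simp; linarith)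
    exact ContinuousAt.comp (f := fun w : ℂ => -(ee * w)) (g := fun x : ℂ => x ^ (z - 1)) this (by fun_prop)
  refine ContinuousAt.div ((continuousAt_const.mul c1).mul (by fun_prop)) ED_diff.continuous.continuousAt (ED_ne w hw.1 hw.2)

lemma ff_diff (z w : ℂ) (h1 : 0 < w.im) (h2 : w.im < Real.sqrt 2 / 4) : DifferentiableAt ℂ (ff z) w := by
  have hw : w ≠ 0 := by intro h; rw [h] at h1; simp at h1
  have hsl : -(ee * w) ∈ Complex.slitPlane := by
    rw [Complex.mem_slitPlane_iff]
    by_cases h : (-(ee * w)).im = 0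
    · left
      have h3 := (ew_cond w h1.le).resolve_right (by simpa using h)
      refine lt_of_le_of_ne h3 ?_
      intro h4
      have : -(ee * w) = 0 := Complex.ext h4.symm h
      exact neg_ne_zero.2 (mul_ne_zero ee_ne hw) this
    · right; exact h
  unfold ff
  refine DifferentiableAt.div (DifferentiableAt.mul ?_ (by fun_prop)) DD_diff.differentiableAt (DD_ne w h1.le h2.le hw)
  exact DifferentiableAt.cpow_const (by fun_prop) hsl

lemma ff_bound (z : ℂ) (hz : 1 < z.re) : ∃ K, ∀ w : ℂ, 0 ≤ w.im → w.im ≤ Real.sqrt 2 / 4 →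
    ‖ff z w‖ ≤ K * Real.exp (-1 * w.re ^ 2) := by
  obtain ⟨K1, hK1⟩ := ((isCompact_Icc (a := (-1 : ℝ)) (b := 1)).reProdIm (isCompact_Icc (a := (0 : ℝ)) (b := Real.sqrt 2 / 4))).exists_bound_of_continuousOn
    ((ff_cont z hz).mono (fun w hw => hw.2))
  have hs : Real.sqrt 2 ^ 2 = 2 := Real.sq_sqrt (by norm_num)
  have hs1 : 1 ≤ Real.sqrt 2 := Real.one_le_sqrt.2 (by norm_num)
  have hs2 : Real.sqrt 2 ≤ 1.5 := by nlinarith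
  have hpi := Real.pi_gt_three
  have hpi4 := Real.pi_le_four
  set K2 := Real.exp (Real.pi * |z.im| + z.re ^ 2 + 1) with hK2
  refine ⟨max (K1 * Real.exp 1) K2, fun w h1 h2 => ?_⟩
  by_cases hx : w.re ∈ Icc (-1 : ℝ) 1
  · have a1 := hK1 w ⟨hx, h1, h2⟩
    have a2 : 1 ≤ Real.exp 1 * Real.exp (-1 * w.re ^ 2) := by
      rw [← Real.exp_add]; apply Real.one_le_exp; nlinarith [hx.1, hx.2]
    have a3 : 0 ≤ K1 := (norm_nonneg _).trans a1
    calc ‖ff z w‖ ≤ K1 * 1 := by linarith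
      _ ≤ K1 * (Real.exp 1 * Real.exp (-1 * w.re ^ 2)) := by gcongr
      _ = K1 * Real.exp 1 * Real.exp (-1 * w.re ^ 2) := by ring
      _ ≤ _ := by gcongr; exact le_max_left _ _
  · have hx1 : 1 ≤ |w.re| := by
      by_contra hc; push Not at hc
      exact hx ⟨(abs_lt.1 hc).1.le, (abs_lt.1 hc).2.le⟩
    have hD : 1 ≤ ‖DD w‖ := by
      refine le_trans ?_ (DD_ge w)
      rw [abs_mul, abs_of_pos (by positivity : 0 < Real.pi * (Real.sqrt 2 / 2))]
      have : 1 / 2 ≤ |w.re + w.im| := by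
        have h3 := abs_sub_abs_le_abs_sub w.re (-w.im)
        rw [abs_neg, sub_neg_eq_add, abs_of_nonneg h1] at h3
        linarith
      have h4 : 1 ≤ Real.pi * (Real.sqrt 2 / 2) := by nlinarith
      nlinarith
    have hP : ‖(-(ee * w)) ^ z‖ ≤ Real.exp (z.re * |w.re|) * Real.exp (Real.pi * |z.im|) := by
      refine (Complex.norm_cpow_le _ _).trans ?_
      rw [norm_neg, norm_mul, ee_norm, one_mul, div_eq_mul_inv, ← Real.exp_neg]
      gcongr
      · have : ‖w‖ ≤ Real.exp |w.re| := by
          refine le_trans ?_ (Real.add_one_le_exp _)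
          refine (Complex.norm_le_abs_re_add_abs_im w).trans ?_
          rw [abs_of_nonneg h1]; linarith
        calc ‖w‖ ^ z.re ≤ Real.exp |w.re| ^ z.re := by gcongr
          _ = _ := by rw [← Real.exp_mul, mul_comm]
      · refine (neg_le_abs _).trans ?_
        rw [abs_mul]
        gcongr
        exact Complex.abs_arg_le_pi _
    have hE : ‖Complex.exp (-(Real.pi * w ^ 2))‖ ≤ Real.exp (-(2 * w.re ^ 2) + 1) := by
      rw [Complex.norm_exp]
      apply Real.exp_le_exp.2
      have : (-(Real.pi * w ^ 2) : ℂ).re = -(Real.pi * (w.re ^ 2 - w.im ^ 2)) := by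
        rw [Complex.neg_re, Complex.re_ofReal_mul, pow_two w]; simp; ring
      rw [this]
      have : w.im ^ 2 ≤ 1 / 8 := by nlinarith
      nlinarith [sq_nonneg w.re]
    rw [ff, norm_div, norm_mul]
    calc _ ≤ ‖(-(ee * w)) ^ z‖ * ‖Complex.exp (-(Real.pi * w ^ 2))‖ := div_le_self (by positivity) hD
      _ ≤ (Real.exp (z.re * |w.re|) * Real.exp (Real.pi * |z.im|)) * Real.exp (-(2 * w.re ^ 2) + 1) := by gcongr
      _ ≤ K2 * Real.exp (-1 * w.re ^ 2) := by
        rw [hK2, ← Real.exp_add, ← Real.exp_add, ← Real.exp_add]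
        apply Real.exp_le_exp.2
        nlinarith [sq_nonneg (z.re - |w.re|), sq_abs w.re, sq_nonneg z.re]
      _ ≤ _ := by gcongr; exact le_max_right _ _

lemma ff_shift (z : ℂ) (hz : 1 < z.re) :
    ∫ x : ℝ, ff z (x + (Real.sqrt 2 / 4 : ℝ) * Complex.I) = ∫ x : ℝ, ff z x := by
  obtain ⟨K, hK⟩ := ff_bound z hz
  exact strip_shift (ff z) _ K (by positivity) (ff_cont z hz) (fun w h1 h2 => ff_diff z w h1 h2) hK

lemma ff_int (z : ℂ) (hz : 1 < z.re) : Integrable (fun x : ℝ => ff z x) := by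
  obtain ⟨K, hK⟩ := ff_bound z hz
  have := strip_integrable (ff z) (Real.sqrt 2 / 4) 0 K ⟨le_rfl, by positivity⟩ (ff_cont z hz) hK
  simpa using this

lemma rline_eq (u : ℝ) : rline u = -(ee * ((u - Real.sqrt 2 / 4 : ℝ) + (Real.sqrt 2 / 4 : ℝ) * Complex.I)) := by
  have h : ((u - Real.sqrt 2 / 4 : ℝ) + (Real.sqrt 2 / 4 : ℝ) * Complex.I : ℂ) = u - cc / 2 := by
    rw [cc_eq]; push_cast; ring
  rw [h, rline]
  change 1 / 2 - ee * u = _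
  linear_combination (-1 / 2) * ee_cc

lemma R_eq (s : ℂ) (hs : 1 < (-s).re) : RiemannR s = -ee * ∫ x : ℝ, ff (-s) x := by
  rw [RiemannR, ← ff_shift (-s) hs]
  rw [← integral_sub_right_eq_self (μ := volume) (fun x : ℝ => ff (-s) (x + (Real.sqrt 2 / 4 : ℝ) * Complex.I)) (Real.sqrt 2 / 4)]
  change -ee * _ = _
  congr 2
  funext u
  rw [rline_eq, ff, DD]
  set w : ℂ := ((u - Real.sqrt 2 / 4 : ℝ) + (Real.sqrt 2 / 4 : ℝ) * Complex.I)
  have e1 : Real.pi * Complex.I * (-(ee * w)) ^ 2 = -(Real.pi * w ^ 2) := by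
    linear_combination Real.pi * Complex.I * w ^ 2 * ee_sq + Real.pi * w ^ 2 * Complex.I_sq
  have e2 : Real.pi * Complex.I * (-(ee * w)) = Real.pi * cc * w := by
    linear_combination -Real.pi * w * ee_I
  rw [e1, e2]

noncomputable def JJ (z : ℂ) (r : ℝ) : ℂ := (r : ℂ) ^ z * Complex.exp (-(Real.pi * r ^ 2)) / DD r

lemma cpow_scale (r : ℝ) (x z : ℂ) (hr : 0 < r) (hx : x ≠ 0) : (r * x : ℂ) ^ z = (r : ℂ) ^ z * x ^ z := by
  have hrc : (r : ℂ) ≠ 0 := by exact_mod_cast hr.ne'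
  rw [Complex.cpow_def_of_ne_zero (mul_ne_zero hrc hx), Complex.cpow_def_of_ne_zero hrc, Complex.cpow_def_of_ne_zero hx,
    Complex.log_ofReal_mul hr hx, ← Complex.exp_add, ← Complex.ofReal_log hr.le]
  ring_nf

lemma DD_neg (w : ℂ) : DD (-w) = -DD w := by
  unfold DD; rw [mul_neg, neg_neg]; ring

lemma ff_pos (z : ℂ) (r : ℝ) (hr : 0 < r) : ff z r = (-ee) ^ z * JJ z r := by
  rw [ff, JJ, show -(ee * (r : ℂ)) = r * (-ee) by ring, cpow_scale r _ z hr (neg_ne_zero.2 ee_ne)]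
  ring

lemma ff_neg (z : ℂ) (r : ℝ) (hr : 0 < r) : ff z ((-r : ℝ) : ℂ) = -(ee ^ z * JJ z r) := by
  rw [ff, JJ, show -(ee * ((-r : ℝ) : ℂ)) = r * ee by push_cast; ring, cpow_scale r _ z hr ee_ne]
  push_cast
  rw [DD_neg, neg_sq, div_neg]
  ring

lemma ff_split (z : ℂ) (hz : 1 < z.re) :
    ∫ x : ℝ, ff z x = ((-ee) ^ z - ee ^ z) * ∫ r in Ioi (0 : ℝ), JJ z r := by
  have hi := ff_int z hz
  rw [← intervalIntegral.integral_Iic_add_Ioi (b := 0) hi.integrableOn hi.integrableOn]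
  have h1 : ∫ x in Iic (0 : ℝ), ff z x = ∫ x in Ioi (0 : ℝ), ff z ((-x : ℝ) : ℂ) := by
    have := integral_comp_neg_Ioi (0 : ℝ) (fun x : ℝ => ff z x)
    rw [neg_zero] at this
    exact this.symm
  have h2 : ∫ x in Ioi (0 : ℝ), ff z ((-x : ℝ) : ℂ) = ∫ x in Ioi (0 : ℝ), -(ee ^ z) * JJ z x :=
    setIntegral_congr_fun measurableSet_Ioi fun r hr => by
      change ff z ((-r : ℝ) : ℂ) = _
      rw [ff_neg z r hr]; ring
  have h3 : ∫ x in Ioi (0 : ℝ), ff z x = ∫ x in Ioi (0 : ℝ), (-ee) ^ z * JJ z x :=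
    setIntegral_congr_fun measurableSet_Ioi fun r hr => by
      change ff z r = _
      rw [ff_pos z r hr]
  rw [h1, h2, h3, integral_const_mul, integral_const_mul]
  ring

lemma ee_pow_ne (z : ℂ) (hz : z.im < 0) : (-ee) ^ z - ee ^ z ≠ 0 := by
  have hpi := Real.pi_pos
  have l1 : Complex.log ee = Real.pi * Complex.I / 4 := by
    rw [ee, Complex.log_exp]
    · simp; linarith
    · simp; linarith
  have e2 : -ee = Complex.exp (-(3 * Real.pi / 4 : ℝ) * Complex.I) := by
    have : (-(3 * Real.pi / 4 : ℝ) * Complex.I : ℂ) = Real.pi * Complex.I / 4 - Real.pi * Complex.I := by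
      push_cast; ring
    rw [this, Complex.exp_sub, Complex.exp_pi_mul_I, ee, div_neg, div_one]
  have l2 : Complex.log (-ee) = -(3 * Real.pi / 4 : ℝ) * Complex.I := by
    rw [e2, Complex.log_exp]
    · simp; linarith
    · simp; linarith
  intro h
  rw [sub_eq_zero, Complex.cpow_def_of_ne_zero ee_ne, Complex.cpow_def_of_ne_zero (neg_ne_zero.2 ee_ne), l1, l2] at h
  have h' := congrArg norm h
  rw [Complex.norm_exp, Complex.norm_exp, Real.exp_eq_exp] at h'
  have r1 : (-(3 * Real.pi / 4 : ℝ) * Complex.I * z : ℂ).re = 3 * Real.pi / 4 * z.im := by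
    simp
  have r2 : (Real.pi * Complex.I / 4 * z : ℂ).re = -(Real.pi / 4 * z.im) := by
    have : (Real.pi * Complex.I / 4 * z : ℂ) = ((Real.pi / 4 : ℝ) : ℂ) * (Complex.I * z) := by push_cast; ring
    rw [this, Complex.re_ofReal_mul]; simp
  rw [r1, r2] at h'
  nlinarith

lemma JJ_sum (z : ℂ) (r : ℝ) (hr : 0 < r) : HasSum (fun k : ℕ => KK z (k + 1 / 2) r) (JJ z r) := by
  have hpi := Real.pi_pos
  set q : ℂ := Complex.exp (-(2 * (Real.pi * cc * r))) with hq
  have hre : 0 < (Real.pi * cc * r : ℂ).re := by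
    rw [cw_re]; simp; positivity
  have hq1 : ‖q‖ < 1 := by
    rw [hq, Complex.norm_exp, Real.exp_lt_one_iff, Complex.neg_re]
    have : (2 * (Real.pi * cc * r) : ℂ).re = 2 * (Real.pi * cc * r : ℂ).re := by
      simp
    rw [this]; linarith
  have hg := (hasSum_geometric_of_norm_lt_one hq1).mul_left ((r : ℂ) ^ z * Complex.exp (-(Real.pi * r ^ 2)) * Complex.exp (-(Real.pi * cc * r)))
  have ef : (fun k : ℕ => KK z (k + 1 / 2) r) = fun k : ℕ => (r : ℂ) ^ z * Complex.exp (-(Real.pi * r ^ 2)) * Complex.exp (-(Real.pi * cc * r)) * q ^ k := by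
    funext k
    rw [KK, hq, ← Complex.exp_nat_mul]
    have e : (-(Real.pi * r ^ 2) - 2 * Real.pi * cc * ((k + 1 / 2 : ℝ) : ℂ) * r : ℂ) =
      -(Real.pi * r ^ 2) + -(Real.pi * cc * r) + k * -(2 * (Real.pi * cc * r)) := by push_cast; ring
    rw [e, Complex.exp_add, Complex.exp_add]; ring
  have ev : JJ z r = (r : ℂ) ^ z * Complex.exp (-(Real.pi * r ^ 2)) * Complex.exp (-(Real.pi * cc * r)) * (1 - q)⁻¹ := by
    have hD : DD r * Complex.exp (-(Real.pi * cc * r)) = 1 - q := by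
      rw [DD, sub_mul, ← Complex.exp_add, ← Complex.exp_add, hq]
      rw [add_neg_cancel, Complex.exp_zero]
      congr 2; ring
    have hne := Complex.exp_ne_zero (-(Real.pi * cc * r))
    have h1q : 1 - q ≠ 0 := by
      intro h
      have : q = 1 := by linear_combination -h
      rw [this] at hq1; simp at hq1
    have hDne : DD r ≠ 0 := by
      intro h; rw [h, zero_mul] at hD; exact h1q hD.symm
    rw [← hD, JJ]
    field_simp
  rw [ef, ev]; exact hg

lemma KK_norm_summable (z : ℂ) (hz : 0 < z.re) :
    Summable (fun k : ℕ => ∫ r in Ioi (0 : ℝ), ‖KK z (k + 1 / 2) r‖) := by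
  have hpi := Real.pi_gt_three
  have hs1 : 1 ≤ Real.sqrt 2 := Real.one_le_sqrt.2 (by norm_num)
  have hsum : Summable (fun k : ℕ => (1 / ((k + 1 : ℕ) : ℝ) ^ (z.re + 1)) * Real.Gamma (z.re + 1)) :=
    ((summable_nat_add_iff 1).2 (Real.summable_one_div_nat_rpow.2 (by linarith : 1 < z.re + 1))).mul_right _
  refine Summable.of_nonneg_of_le (fun k => integral_nonneg fun r => norm_nonneg _) (fun k => ?_) hsum
  have hk : (0 : ℝ) ≤ k := k.cast_nonneg
  have hb : 0 < Real.sqrt 2 * Real.pi * (k + 1 / 2) := by positivity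
  have hG := Real.integral_rpow_mul_exp_neg_mul_Ioi (a := z.re + 1) (r := Real.sqrt 2 * Real.pi * (k + 1 / 2)) (by linarith) hb
  rw [add_sub_cancel_right] at hG
  calc ∫ r in Ioi (0 : ℝ), ‖KK z (k + 1 / 2) r‖
      ≤ ∫ r in Ioi (0 : ℝ), r ^ z.re * Real.exp (-(Real.sqrt 2 * Real.pi * (k + 1 / 2)) * r) := by
        refine setIntegral_mono_on (KK_integrable z _ (by linarith) (by positivity)).norm
          (integrableOn_bound _ _ (by linarith) hb) measurableSet_Ioi fun r hr => norm_KK_le z _ r hr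
    _ = (1 / (Real.sqrt 2 * Real.pi * (k + 1 / 2))) ^ (z.re + 1) * Real.Gamma (z.re + 1) := by
        rw [← hG]; congr 1; funext r; rw [neg_mul]
    _ ≤ _ := by
        have hGp : 0 < Real.Gamma (z.re + 1) := Real.Gamma_pos_of_pos (by linarith)
        gcongr
        have e : 1 / ((k + 1 : ℕ) : ℝ) ^ (z.re + 1) = (1 / ((k + 1 : ℕ) : ℝ)) ^ (z.re + 1) := by
          rw [Real.div_rpow zero_le_one (by positivity), Real.one_rpow]
        rw [e]
        apply Real.rpow_le_rpow (by positivity) _ (by linarith)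
        apply one_div_le_one_div_of_le (by positivity)
        push_cast
        have : 3 ≤ Real.sqrt 2 * Real.pi := by nlinarith
        nlinarith

lemma reduction (s : ℂ) (hs : s.re < -1) (hi : 0 < s.im) (h : RiemannR s = 0) :
    HasSum (fun k : ℕ => HH (-s) (k + 1 / 2)) 0 := by
  have hz : 1 < (-s).re := by rw [Complex.neg_re]; linarith
  rw [R_eq s hz, ff_split _ hz] at h
  have h1 := (mul_eq_zero.1 h).resolve_left (neg_ne_zero.2 ee_ne)
  have h2 := (mul_eq_zero.1 h1).resolve_left (ee_pow_ne _ (by rw [Complex.neg_im]; linarith))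
  have h3 := hasSum_integral_of_summable_integral_norm (μ := volume.restrict (Ioi (0 : ℝ)))
    (F := fun (k : ℕ) r => KK (-s) (k + 1 / 2) r)
    (fun k => KK_integrable (-s) _ (by linarith) (by positivity)) (KK_norm_summable (-s) (by linarith))
  have h4 : ∫ r in Ioi (0 : ℝ), ∑' k : ℕ, KK (-s) (k + 1 / 2) r = 0 := by
    rw [← h2]
    exact setIntegral_congr_fun measurableSet_Ioi fun r hr => (JJ_sum (-s) r hr).tsum_eq
  rw [h4] at h3
  exact h3

lemma final_aux (z : ℂ) (t : ℝ) (ht1 : 1 ≤ t) (him : z.im = -t) (hn : 200000 * t ^ ((2 : ℝ) / 5) < z.re)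
    (hS : HasSum (fun k : ℕ => HH z (k + 1 / 2)) 0) : False := by
  have hpi := Real.pi_gt_three
  have hpi4 := Real.pi_lt_d2
  set x := t ^ ((2 : ℝ) / 5) with hx
  have hx1 : 1 ≤ x := Real.one_le_rpow ht1 (by norm_num)
  have hx5 : x ^ 5 = t ^ 2 := by
    rw [hx, ← Real.rpow_natCast, ← Real.rpow_mul (by linarith), ← Real.rpow_natCast]
    norm_num
  have hz : 0 < z.re := by linarith
  have hT0 : 0 ≤ TT z := TT_nonneg z (by linarith)
  have hT : TT z ≤ 7 * t := by unfold TT; rw [him]; nlinarith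
  have hb : 1200000 * x ≤ bb z := by unfold bb; nlinarith
  have hb1 : 1200000 ≤ bb z := by linarith
  have hs := ss_pos z hz (by linarith)
  have hss : ss z ^ 2 = TT z + bb z := Real.sq_sqrt (by linarith)
  by_cases hc : 32 * ss z ≤ bb z
  · have := main_ineq z hz (by linarith) (by linarith) 1 one_pos le_rfl (by linarith) hS
    rw [one_pow, mul_one] at this
    nlinarith
  · push Not at hc
    have hμ : bb z / (32 * ss z) ≤ 1 := by rw [div_le_one (by positivity)]; exact hc.le
    have := main_ineq z hz (by linarith) (by linarith) (bb z / (32 * ss z)) (by positivity) hμ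
      (by field_simp; rfl) hS
    have e : ss z * (bb z / (32 * ss z)) ^ 5 = bb z ^ 5 / (32 ^ 5 * (ss z ^ 2) ^ 2) := by
      field_simp
    rw [e, div_le_iff₀ (by positivity), hss] at this
    rcases le_total (TT z) (bb z) with h | h
    · have h1 : (TT z + bb z) ^ 2 ≤ (2 * bb z) ^ 2 := by gcongr; linarith
      have h2 : bb z ^ 3 * bb z ^ 2 ≤ (864 * 32 ^ 5 * 4) * bb z ^ 2 := by nlinarith
      have h3 := le_of_mul_le_mul_right h2 (by positivity)
      have h4 : (1200000 : ℝ) ^ 3 ≤ bb z ^ 3 := by gcongr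
      norm_num at h3 h4
      linarith
    · have h1 : (TT z + bb z) ^ 2 ≤ (14 * t) ^ 2 := by gcongr; linarith
      have h2 : (1200000 * x) ^ 5 ≤ bb z ^ 5 := by gcongr
      rw [mul_pow, hx5] at h2
      have h3 : 0 < t ^ 2 := by positivity
      norm_num at this h2
      nlinarith

/-- There are `A > 0` and `t₀ ≥ e` such that every zero `ρ = β + iγ` of `R`
with `γ ≥ t₀` satisfies `β ≥ −A γ^{2/5} log γ`. -/
theorem re_zero_R_lower_bound :
    ∃ A > (0 : ℝ), ∃ t₀ : ℝ, Real.exp 1 ≤ t₀ ∧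
      ∀ ρ : ℂ, RiemannR ρ = 0 → t₀ ≤ ρ.im →
        -A * ρ.im ^ ((2 : ℝ) / 5) * Real.log ρ.im ≤ ρ.re := by
  refine ⟨200000, by norm_num, Real.exp 1, le_rfl, fun ρ h0 ht => ?_⟩
  by_contra hc
  push Not at hc
  have he : 1 ≤ Real.exp 1 := Real.one_le_exp zero_le_one
  have ht1 : 1 ≤ ρ.im := he.trans ht
  have hlog : 1 ≤ Real.log ρ.im := by
    rw [Real.le_log_iff_exp_le (by linarith)]; exact ht
  have hx1 : 1 ≤ ρ.im ^ ((2 : ℝ) / 5) := Real.one_le_rpow ht1 (by norm_num)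
  have hn : 200000 * ρ.im ^ ((2 : ℝ) / 5) < (-ρ).re := by
    rw [Complex.neg_re]; nlinarith
  exact final_aux (-ρ) ρ.im ht1 (by simp) hn
    (reduction ρ (by rw [Complex.neg_re] at hn; linarith) (by linarith) h0)
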